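/- Fix β > 0, set θ = β/2, let k ≥ 1, and let p be a symmetric polynomial in k real variables of total degree d. Suppose u : [0,∞) × ℝ^k → ℝ satisfies: (i) for every t ≥ 0, u(t,·) is a symmetric polynomial in k variables of total degree at most d; (ii) for every z ∈ ℝ^k, t ↦ u(t,z) is continuously differentiable; (iii) u(0,·) = p; and (iv) for every t ≥ 0 and every z with pairwise distinct coordinates, ∂u/∂t(t,z) = (Ã^{(k)}u(t,·))(z), where Ã^{(m)} := A^{(m)} − (1/2) Σ_{i=1}^m z_i ∂/∂z_i. Suppose v : [0,∞) × ℝ^{k+1} → ℝ satisfies the analogous conditions in k+1 variables with degree at most d, with generator Ã^{(k+1)}, and with initial condition v(0,x) = ∫_{W^{(k)}(x)} Λ^{(k)}(x,y) p(y) dy for every strictly increasing x ∈ ℝ^{k+1}. Then for every t ≥ 0 and every strictly increasing x = (x_1 < … < x_{k+1}) ∈ ℝ^{k+1}, ∫_{W^{(k)}(x)} Λ^{(k)}(x,y) u(t,y) dy = v(t,x). -/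

import Mathlib

open Finset MeasureTheory

/-- First-order partial derivative `∂f/∂z_i (z)`. -/
noncomputable def pd {m : ℕ} (f : (Fin m → ℝ) → ℝ) (i : Fin m) (z : Fin m → ℝ) : ℝ :=
  fderiv ℝ f z (Pi.single i 1)

/-- Second-order partial derivative `∂²f/∂z_i² (z)`. -/
noncomputable def pd2 {m : ℕ} (f : (Fin m → ℝ) → ℝ) (i : Fin m) (z : Fin m → ℝ) : ℝ :=
  fderiv ℝ (fun w => fderiv ℝ f w (Pi.single i 1)) z (Pi.single i 1)

/-- The generator `A^{(m)}` of the `m`-dimensional `β`-Dyson Brownian motion, with `θ = β/2`: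
`(A^{(m)}f)(z) = (1/2) Σ_i ∂²f/∂z_i²(z) + θ Σ_i Σ_{j≠i} (1/(z_i-z_j)) ∂f/∂z_i(z)`. -/
noncomputable def genA {m : ℕ} (θ : ℝ) (f : (Fin m → ℝ) → ℝ) (z : Fin m → ℝ) : ℝ :=
  (1 / 2) * ∑ i, pd2 f i z +
    θ * ∑ i, ∑ j ∈ univ.erase i, (1 / (z i - z j)) * pd f i z

/-- The interlacing domain `W^{(k)}(x) = {y : x_1 ≤ y_1 ≤ x_2 ≤ y_2 ≤ … ≤ y_k ≤ x_{k+1}}`. -/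
def DAdomain (k : ℕ) (x : Fin (k + 1) → ℝ) : Set (Fin k → ℝ) :=
  {y | ∀ i : Fin k, x i.castSucc ≤ y i ∧ y i ≤ x i.succ}

/-- The Dixon–Anderson conditional probability density `Λ^{(k)}(x,y)` with parameter `β`. -/
noncomputable def DAdensity (k : ℕ) (β : ℝ) (x : Fin (k + 1) → ℝ) (y : Fin k → ℝ) : ℝ :=
  (Real.Gamma (β * (k + 1) / 2) / Real.Gamma (β / 2) ^ (k + 1)) *
    (∏ i : Fin (k + 1), ∏ j ∈ Ioi i, (x j - x i) ^ (1 - β)) *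
    (∏ i : Fin k, ∏ j ∈ Ioi i, (y j - y i)) *
    (∏ i : Fin k, ∏ j : Fin (k + 1), |y i - x j| ^ (β / 2 - 1))

/-- The generator `Ã^{(m)} = A^{(m)} - (1/2) Σ_i z_i ∂/∂z_i` of the `m`-dimensional
`β`-Dyson Ornstein–Uhlenbeck process, with `θ = β/2`. -/
noncomputable def genOU {m : ℕ} (θ : ℝ) (f : (Fin m → ℝ) → ℝ) (z : Fin m → ℝ) : ℝ :=
  genA θ f z - (1 / 2) * ∑ i, z i * pd f i z


theorem ode_lin {V X : Type*} [AddCommGroup V] [Module ℝ V] [FiniteDimensional ℝ V]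
    (ev B : X → Module.Dual ℝ V) (hsep : ∀ v, (∀ x, ev x v = 0) → v = 0) (h : ℝ → V)
    (hd : ∀ t : ℝ, 0 ≤ t → ∀ x, HasDerivWithinAt (fun s => ev x (h s)) (B x (h t)) (Set.Ici 0) t) :
    ∃ M : V →ₗ[ℝ] V, ∀ ψ : Module.Dual ℝ V, ∀ t : ℝ, 0 ≤ t →
      HasDerivWithinAt (fun s => ψ (h s)) (ψ (M (h t))) (Set.Ici 0) t := by
  have hspan : Submodule.span ℝ (Set.range ev) = ⊤ := by
    have : (Submodule.span ℝ (Set.range ev)).dualCoannihilator = ⊥ := by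
      rw [eq_bot_iff]
      intro v hv
      rw [Submodule.mem_dualCoannihilator] at hv
      exact hsep v fun x => hv _ (Submodule.subset_span ⟨x, rfl⟩)
    have h2 := Subspace.dualCoannihilator_dualAnnihilator_eq (W := Submodule.span ℝ (Set.range ev))
    rw [this] at h2
    simpa using h2.symm
  have key : ∀ ψ : Module.Dual ℝ V, ∃ B' : Module.Dual ℝ V, ∀ t : ℝ, 0 ≤ t →
      HasDerivWithinAt (fun s => ψ (h s)) (B' (h t)) (Set.Ici 0) t := by
    intro ψ
    have hψ : ψ ∈ Submodule.span ℝ (Set.range ev) := by rw [hspan]; trivial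
    induction hψ using Submodule.span_induction with
    | mem y hy => obtain ⟨x, rfl⟩ := hy; exact ⟨B x, fun t ht => hd t ht x⟩
    | zero => exact ⟨0, fun t ht => by simpa using hasDerivWithinAt_const t _ (0:ℝ)⟩
    | add a b _ _ ha hb =>
      obtain ⟨a', ha⟩ := ha
      obtain ⟨b', hb⟩ := hb
      exact ⟨a' + b', fun t ht => (ha t ht).add (hb t ht)⟩
    | smul c a _ ha =>
      obtain ⟨a', ha⟩ := ha
      exact ⟨c • a', fun t ht => by simpa using (ha t ht).const_mul c⟩
  let b := Module.finBasis ℝ V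
  choose B' hB' using key
  refine ⟨∑ i, (B' (b.coord i)).smulRight (b i), fun ψ t ht => ?_⟩
  have e : ∀ v, ψ v = ∑ i, ψ (b i) * b.coord i v := by
    intro v
    conv_lhs => rw [← b.sum_repr v]
    simp only [map_sum, map_smul, smul_eq_mul, Module.Basis.coord_apply, mul_comm]
  have e2 : ψ ((∑ i, (B' (b.coord i)).smulRight (b i)) (h t)) = ∑ i, ψ (b i) * B' (b.coord i) (h t) := by
    simp [LinearMap.sum_apply]
    try simp only [mul_comm]
  rw [e2]
  simp_rw [e (h _)]
  exact HasDerivWithinAt.fun_sum fun i _ => (hB' (b.coord i) t ht).const_mul _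

theorem ode_uniq {V X : Type*} [AddCommGroup V] [Module ℝ V] [FiniteDimensional ℝ V]
    (ev B : X → Module.Dual ℝ V) (hsep : ∀ v, (∀ x, ev x v = 0) → v = 0) (h : ℝ → V)
    (hd : ∀ t : ℝ, 0 ≤ t → ∀ x, HasDerivWithinAt (fun s => ev x (h s)) (B x (h t)) (Set.Ici 0) t)
    (h0 : h 0 = 0) : ∀ t : ℝ, 0 ≤ t → h t = 0 := by
  obtain ⟨M, hM⟩ := ode_lin ev B hsep h hd
  intro T hT
  let b := Module.finBasis ℝ V
  let e := b.equivFun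
  let N := LinearMap.toContinuousLinearMap (e.toLinearMap ∘ₗ M ∘ₗ e.symm.toLinearMap)
  have hg : ∀ t : ℝ, 0 ≤ t → HasDerivWithinAt (fun s => e (h s)) (N (e (h t))) (Set.Ici 0) t := by
    intro t ht
    rw [hasDerivWithinAt_pi]
    intro i
    have := hM (b.coord i) t ht
    simpa [N, e] using this
  have := eq_zero_of_abs_deriv_le_mul_abs_self_of_eq_zero_right (f := fun s => e (h s))
    (f' := fun s => N (e (h s))) (K := ‖N‖) (a := 0) (b := T)
    (fun t ht => ((hg t ht.1).continuousWithinAt).mono Set.Icc_subset_Ici_self)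
    (fun t ht => (hg t ht.1).mono (Set.Ici_subset_Ici.2 ht.1)) (by simp [h0])
    (fun t ht => N.le_opNorm _) T ⟨hT, le_rfl⟩
  simpa using this


section lop
variable {R : Type*} [CommRing R] [Algebra ℝ R] {ι : Type*} [Fintype ι]

noncomputable def Lop (ε : R →ₐ[ℝ] ℝ) (D : ι → Derivation ℝ R R) (c e : ι → ℝ) (f : R) : ℝ :=
  ∑ a, (c a * ε (D a (D a f)) + e a * ε (D a f))

noncomputable def Gam (ε : R →ₐ[ℝ] ℝ) (D : ι → Derivation ℝ R R) (c : ι → ℝ) (f g : R) : ℝ :=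
  ∑ a, 2 * c a * ε (D a f) * ε (D a g)

theorem Lop_mul (ε : R →ₐ[ℝ] ℝ) (D : ι → Derivation ℝ R R) (c e : ι → ℝ) (f g : R) :
    Lop ε D c e (f * g) = ε f * Lop ε D c e g + ε g * Lop ε D c e f + Gam ε D c f g := by
  unfold Lop Gam
  rw [mul_sum, mul_sum, ← sum_add_distrib, ← sum_add_distrib]
  refine sum_congr rfl fun a _ => ?_
  simp only [Derivation.leibniz, map_add, smul_eq_mul, map_mul]
  ring

theorem Lop_add (ε : R →ₐ[ℝ] ℝ) (D : ι → Derivation ℝ R R) (c e : ι → ℝ) (f g : R) :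
    Lop ε D c e (f + g) = Lop ε D c e f + Lop ε D c e g := by
  unfold Lop
  rw [← sum_add_distrib]
  refine sum_congr rfl fun a _ => ?_
  simp only [map_add]
  ring

theorem Lop_alg (ε : R →ₐ[ℝ] ℝ) (D : ι → Derivation ℝ R R) (c e : ι → ℝ) (r : ℝ) :
    Lop ε D c e (algebraMap ℝ R r) = 0 := by
  simp [Lop]

theorem Gam_mul (ε : R →ₐ[ℝ] ℝ) (D : ι → Derivation ℝ R R) (c : ι → ℝ) (f g h : R) :
    Gam ε D c (f * g) h = ε f * Gam ε D c g h + ε g * Gam ε D c f h := by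
  unfold Gam
  rw [mul_sum, mul_sum, ← sum_add_distrib]
  refine sum_congr rfl fun a _ => ?_
  simp only [Derivation.leibniz, map_add, smul_eq_mul, map_mul]
  ring

theorem Gam_add (ε : R →ₐ[ℝ] ℝ) (D : ι → Derivation ℝ R R) (c : ι → ℝ) (f g h : R) :
    Gam ε D c (f + g) h = Gam ε D c f h + Gam ε D c g h := by
  unfold Gam
  rw [← sum_add_distrib]
  refine sum_congr rfl fun a _ => ?_
  simp only [map_add]
  ring

theorem Gam_alg (ε : R →ₐ[ℝ] ℝ) (D : ι → Derivation ℝ R R) (c : ι → ℝ) (r : ℝ) (h : R) :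
    Gam ε D c (algebraMap ℝ R r) h = 0 := by
  simp [Gam]

theorem chain {R' : Type*} [CommRing R'] [Algebra ℝ R'] {ι' : Type*} [Fintype ι']
    (ε : R →ₐ[ℝ] ℝ) (D : ι → Derivation ℝ R R) (c e : ι → ℝ)
    (ε' : R' →ₐ[ℝ] ℝ) (D' : ι' → Derivation ℝ R' R') (c' e' : ι' → ℝ)
    {σ : Type*} (p : σ → R) (P : σ → R')
    (h0 : ∀ z, ε (p z) = ε' (P z))
    (h1 : ∀ z z', Gam ε D c (p z) (p z') = Gam ε' D' c' (P z) (P z'))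
    (h2 : ∀ z, Lop ε D c e (p z) = Lop ε' D' c' e' (P z)) (F : MvPolynomial σ ℝ) :
    Lop ε D c e (MvPolynomial.aeval p F) = Lop ε' D' c' e' (MvPolynomial.aeval P F) := by
  have hε : ∀ F : MvPolynomial σ ℝ, ε (MvPolynomial.aeval p F) = ε' (MvPolynomial.aeval P F) := by
    intro F
    have : ε.comp (MvPolynomial.aeval p) = ε'.comp (MvPolynomial.aeval P) := by
      apply MvPolynomial.algHom_ext
      intro z
      simp [h0]
    exact congrArg (fun g => g F) this
  have hG : ∀ z', ∀ F : MvPolynomial σ ℝ, Gam ε D c (MvPolynomial.aeval p F) (p z') =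
      Gam ε' D' c' (MvPolynomial.aeval P F) (P z') := by
    intro z' F
    induction F using MvPolynomial.induction_on with
    | C a => rw [MvPolynomial.aeval_C, MvPolynomial.aeval_C, Gam_alg, Gam_alg]
    | add f g hf hg => rw [map_add, map_add, Gam_add, Gam_add, hf, hg]
    | mul_X f z hf =>
      rw [map_mul, map_mul, Gam_mul, Gam_mul, hf, hε, MvPolynomial.aeval_X, MvPolynomial.aeval_X,
        h0, h1]
  induction F using MvPolynomial.induction_on with
  | C a => rw [MvPolynomial.aeval_C, MvPolynomial.aeval_C, Lop_alg, Lop_alg]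
  | add f g hf hg => rw [map_add, map_add, Lop_add, Lop_add, hf, hg]
  | mul_X f z hf =>
    rw [map_mul, map_mul, Lop_mul, Lop_mul, hf, hε, MvPolynomial.aeval_X, MvPolynomial.aeval_X,
      h0, h2, hG]

end lop

open MvPolynomial in
theorem pd_prod {N : ℕ} {σ : Type*} (g : Fin N → σ) (hg : Function.Injective g)
    (z : ℝ) (s : Finset (Fin N)) (j : Fin N) :
    pderiv (g j) (∏ n ∈ s, (C z - X (g n)) : MvPolynomial σ ℝ) =
      if j ∈ s then -∏ n ∈ s.erase j, (C z - X (g n)) else 0 := by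
  classical
  have h0 : ∀ s : Finset (Fin N), j ∉ s →
      pderiv (g j) (∏ n ∈ s, (C z - X (g n)) : MvPolynomial σ ℝ) = 0 := by
    intro s
    induction s using Finset.induction_on with
    | empty => simp
    | insert a s ha ih =>
      intro hj
      rw [mem_insert, not_or] at hj
      rw [prod_insert ha, Derivation.leibniz, ih hj.2, map_sub, pderiv_C,
        pderiv_X_of_ne (fun h => hj.1 (hg h).symm)]
      simp
  split_ifs with hj
  · rw [← mul_prod_erase s _ hj, Derivation.leibniz, h0 _ (notMem_erase j s)]
    simp
  · exact h0 s hj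

/-- `∏ (z - y_i)` -/
noncomputable def pY (k : ℕ) (z : ℝ) : MvPolynomial (Fin k) ℝ :=
  ∏ i, (MvPolynomial.C z - MvPolynomial.X i)

noncomputable def qX (k : ℕ) (z : ℝ) (m : Fin (k+1)) : MvPolynomial (Fin (k+1) ⊕ Fin (k+1)) ℝ :=
  ∏ n ∈ univ.erase m, (MvPolynomial.C z - MvPolynomial.X (Sum.inl n))

noncomputable def pX (k : ℕ) (z : ℝ) : MvPolynomial (Fin (k+1) ⊕ Fin (k+1)) ℝ :=
  ∑ m, MvPolynomial.X (Sum.inr m) * qX k z m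

section pt
open MvPolynomial
variable {k : ℕ}

theorem pderiv_pY (z : ℝ) (i : Fin k) : pderiv i (pY k z) = -∏ n ∈ univ.erase i, (C z - X n) := by
  have := pd_prod (fun i : Fin k => i) (fun _ _ h => h) z univ i
  simpa [pY] using this

theorem pderiv2_pY (z : ℝ) (i : Fin k) : pderiv i (pderiv i (pY k z)) = 0 := by
  rw [pderiv_pY, map_neg]
  have := pd_prod (fun i : Fin k => i) (fun _ _ h => h) z (univ.erase i) i
  simpa using this

theorem pderiv_qX (z : ℝ) (m j : Fin (k+1)) : pderiv (Sum.inl j) (qX k z m) =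
    if j = m then 0 else -∏ n ∈ (univ.erase m).erase j, (C z - X (Sum.inl n)) := by
  have := pd_prod (Sum.inl : Fin (k+1) → Fin (k+1) ⊕ Fin (k+1)) Sum.inl_injective z (univ.erase m) j
  rw [qX, this]
  by_cases h : j = m <;> simp [h]

theorem pderiv2_qX (z : ℝ) (m j : Fin (k+1)) :
    pderiv (Sum.inl j) (pderiv (Sum.inl j) (qX k z m)) = 0 := by
  rw [pderiv_qX]
  split_ifs
  · simp
  · have := pd_prod (Sum.inl : Fin (k+1) → Fin (k+1) ⊕ Fin (k+1)) Sum.inl_injective z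
      ((univ.erase m).erase j) j
    rw [map_neg, this]
    simp

theorem pderivr_qX (z : ℝ) (m j : Fin (k+1)) : pderiv (Sum.inr j) (qX k z m) = 0 := by
  unfold qX
  generalize univ.erase m = s
  induction s using Finset.induction_on with
  | empty => simp
  | insert a s ha ih =>
    rw [prod_insert ha, Derivation.leibniz, ih, map_sub, pderiv_C, pderiv_X_of_ne (by simp)]
    simp

theorem pderiv_pX (z : ℝ) (j : Fin (k+1)) : pderiv (Sum.inl j) (pX k z) =
    ∑ m, X (Sum.inr m) * pderiv (Sum.inl j) (qX k z m) := by
  unfold pX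
  rw [map_sum]
  refine sum_congr rfl fun m _ => ?_
  rw [Derivation.leibniz, pderiv_X_of_ne (by simp)]
  simp

theorem pderiv2_pX (z : ℝ) (j : Fin (k+1)) :
    pderiv (Sum.inl j) (pderiv (Sum.inl j) (pX k z)) = 0 := by
  rw [pderiv_pX, map_sum]
  refine sum_eq_zero fun m _ => ?_
  rw [Derivation.leibniz, pderiv_X_of_ne (by simp), pderiv2_qX]
  simp

theorem pderivr_pX (z : ℝ) (j : Fin (k+1)) : pderiv (Sum.inr j) (pX k z) = qX k z j := by
  unfold pX
  rw [map_sum, sum_eq_single j]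
  · rw [Derivation.leibniz, pderivr_qX]; simp
  · intro b _ hb
    rw [Derivation.leibniz, pderivr_qX, pderiv_X_of_ne (by simpa using hb)]; simp
  · simp

end pt


theorem prod_erase_inv {N : ℕ} (x : Fin N → ℝ) (z : ℝ) (hz : ∀ n, z - x n ≠ 0) (s : Finset (Fin N)) (j : Fin N)
    (hj : j ∈ s) : ∏ n ∈ s.erase j, (z - x n) = (∏ n ∈ s, (z - x n)) * (z - x j)⁻¹ := by
  rw [← mul_prod_erase s _ hj]
  field_simp [hz j]

theorem hasDerivAt_prod_sub {N : ℕ} (x : Fin N → ℝ) (s : Finset (Fin N)) (z : ℝ) :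
    HasDerivAt (fun z => ∏ n ∈ s, (z - x n)) (∑ n ∈ s, ∏ l ∈ s.erase n, (z - x l)) z := by
  have := HasDerivAt.fun_finsetProd (u := s) (f := fun n z => z - x n) (f' := fun _ => (1:ℝ)) (x := z)
    (fun n _ => (hasDerivAt_id z).sub_const (x n))
  simpa using this

section
variable {k : ℕ} (x w : Fin (k+1) → ℝ) (y : Fin k → ℝ)
  (hR : ∀ z, ∏ i, (z - y i) = ∑ m, w m * ∏ n ∈ univ.erase m, (z - x n))
include hR

theorem hR1 (z : ℝ) : ∑ i, ∏ l ∈ univ.erase i, (z - y l) =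
    ∑ m, w m * ∑ n ∈ univ.erase m, ∏ l ∈ (univ.erase m).erase n, (z - x l) := by
  have h1 := hasDerivAt_prod_sub y univ z
  rw [funext hR] at h1
  have h2 := HasDerivAt.fun_sum (u := univ) (x := z) fun m _ =>
    (hasDerivAt_prod_sub x (univ.erase m) z).const_mul (w m)
  exact h1.unique h2

theorem hR2 (z : ℝ) : ∑ i, ∑ j ∈ univ.erase i, ∏ l ∈ (univ.erase i).erase j, (z - y l) =
    ∑ m, w m * ∑ n ∈ univ.erase m, ∑ l ∈ (univ.erase m).erase n,
      ∏ r ∈ ((univ.erase m).erase n).erase l, (z - x r) := by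
  have h1 := HasDerivAt.fun_sum (u := univ) (x := z) fun i _ =>
    (hasDerivAt_prod_sub y (univ.erase i) z)
  rw [funext (hR1 x w y hR)] at h1
  have h2 := HasDerivAt.fun_sum (u := univ) (x := z) fun m _ =>
    (HasDerivAt.fun_sum (u := univ.erase m) (x := z) fun n _ =>
      (hasDerivAt_prod_sub x ((univ.erase m).erase n) z)).const_mul (w m)
  exact h1.unique h2

/-- values at a generic z -/
theorem gen0 (z : ℝ) (hz : ∀ n, z - x n ≠ 0) :
    ∏ i, (z - y i) = (∏ n, (z - x n)) * ∑ m, w m * (z - x m)⁻¹ := by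
  rw [hR, mul_sum]
  refine sum_congr rfl fun m _ => ?_
  rw [prod_erase_inv x z hz _ _ (mem_univ m)]; ring

theorem gen1 (z : ℝ) (hz : ∀ n, z - x n ≠ 0) (hy : ∀ n, z - y n ≠ 0) :
    (∏ i, (z - y i)) * ∑ i, (z - y i)⁻¹ = (∏ n, (z - x n)) *
      ((∑ m, w m * (z - x m)⁻¹) * (∑ m, (z - x m)⁻¹) - ∑ m, w m * (z - x m)⁻¹ ^ 2) := by
  have h := hR1 x w y hR z
  have e1 : ∑ i, ∏ l ∈ univ.erase i, (z - y l) = (∏ i, (z - y i)) * ∑ i, (z - y i)⁻¹ := by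
    rw [mul_sum]
    exact sum_congr rfl fun i _ => prod_erase_inv y z hy _ _ (mem_univ i)
  rw [← e1, h, sum_mul, ← sum_sub_distrib, mul_sum]
  refine sum_congr rfl fun m _ => ?_
  have : ∀ n ∈ univ.erase m, ∏ l ∈ (univ.erase m).erase n, (z - x l) =
      (∏ n, (z - x n)) * (z - x m)⁻¹ * (z - x n)⁻¹ := by
    intro n hn
    rw [prod_erase_inv x z hz _ _ hn, prod_erase_inv x z hz _ _ (mem_univ m)]
  rw [sum_congr rfl this, ← mul_sum, sum_erase_eq_sub (mem_univ m)]
  ring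

theorem gen2 (z : ℝ) (hz : ∀ n, z - x n ≠ 0) (hy : ∀ n, z - y n ≠ 0) :
    (∏ i, (z - y i)) * ((∑ i, (z - y i)⁻¹) ^ 2 - ∑ i, (z - y i)⁻¹ ^ 2) = (∏ n, (z - x n)) *
      ((∑ m, w m * (z - x m)⁻¹) * ((∑ m, (z - x m)⁻¹) ^ 2 - ∑ m, (z - x m)⁻¹ ^ 2)
        - 2 * (∑ m, (z - x m)⁻¹) * (∑ m, w m * (z - x m)⁻¹ ^ 2) +
        2 * ∑ m, w m * (z - x m)⁻¹ ^ 3) := by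
  have h := hR2 x w y hR z
  have e1 : ∑ i, ∑ j ∈ univ.erase i, ∏ l ∈ (univ.erase i).erase j, (z - y l) =
      (∏ i, (z - y i)) * ((∑ i, (z - y i)⁻¹) ^ 2 - ∑ i, (z - y i)⁻¹ ^ 2) := by
    rw [sq, sum_mul, ← sum_sub_distrib, mul_sum]
    refine sum_congr rfl fun i _ => ?_
    have : ∀ n ∈ univ.erase i, ∏ l ∈ (univ.erase i).erase n, (z - y l) =
        (∏ n, (z - y n)) * (z - y i)⁻¹ * (z - y n)⁻¹ := by
      intro n hn
      rw [prod_erase_inv y z hy _ _ hn, prod_erase_inv y z hy _ _ (mem_univ i)]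
    rw [sum_congr rfl this, ← mul_sum, sum_erase_eq_sub (mem_univ i)]
    ring
  have e2 : ∀ A A2 : ℝ, (∑ m, w m * (z - x m)⁻¹) * (A ^ 2 - A2)
        - 2 * A * (∑ m, w m * (z - x m)⁻¹ ^ 2) + 2 * ∑ m, w m * (z - x m)⁻¹ ^ 3 =
      ∑ m, (w m * (z - x m)⁻¹ * (A ^ 2 - A2) - 2 * A * (w m * (z - x m)⁻¹ ^ 2) +
        2 * (w m * (z - x m)⁻¹ ^ 3)) := by
    intro A A2
    rw [sum_add_distrib, sum_sub_distrib, ← sum_mul, ← mul_sum, ← mul_sum]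
  rw [← e1, h, e2, mul_sum]
  refine sum_congr rfl fun m _ => ?_
  have : ∀ n ∈ univ.erase m, ∑ l ∈ (univ.erase m).erase n,
      ∏ r ∈ ((univ.erase m).erase n).erase l, (z - x r) =
      (∏ n, (z - x n)) * (z - x m)⁻¹ * ((z - x n)⁻¹ * ((∑ m, (z - x m)⁻¹) - (z - x m)⁻¹) -
        (z - x n)⁻¹ ^ 2) := by
    intro n hn
    have : ∀ l ∈ (univ.erase m).erase n, ∏ r ∈ ((univ.erase m).erase n).erase l, (z - x r) =
        (∏ n, (z - x n)) * (z - x m)⁻¹ * (z - x n)⁻¹ * (z - x l)⁻¹ := by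
      intro l hl
      rw [prod_erase_inv x z hz _ _ hl, prod_erase_inv x z hz _ _ hn,
        prod_erase_inv x z hz _ _ (mem_univ m)]
    rw [sum_congr rfl this, ← mul_sum, sum_erase_eq_sub hn, sum_erase_eq_sub (mem_univ m)]
    ring
  rw [sum_congr rfl this, ← mul_sum, sum_erase_eq_sub (mem_univ m), sum_sub_distrib, ← sum_mul]
  ring

/-- the carré du champ identity, generic -/
theorem gamma_gen (z z' : ℝ) (hz : ∀ n, z - x n ≠ 0) (hy : ∀ n, z - y n ≠ 0)
    (hz' : ∀ n, z' - x n ≠ 0) (hy' : ∀ n, z' - y n ≠ 0) (hzz : z ≠ z') :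
    (∏ i, (z - y i)) * (∏ i, (z' - y i)) * ∑ i, (z - y i)⁻¹ * (z' - y i)⁻¹ =
    (∏ n, (z - x n)) * (∏ n, (z' - x n)) *
    (∑ j, ((z - x j)⁻¹ * ((∑ m, w m * (z - x m)⁻¹) - w j * (z - x j)⁻¹)) *
      ((z' - x j)⁻¹ * ((∑ m, w m * (z' - x m)⁻¹) - w j * (z' - x j)⁻¹)) +
      ((∑ m, w m * ((z - x m)⁻¹ * (z' - x m)⁻¹)) ^ 2 - 
        ∑ m, w m ^ 2 * ((z - x m)⁻¹ * (z' - x m)⁻¹) ^ 2)) := by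
  have hd : z - z' ≠ 0 := sub_ne_zero.2 hzz
  have g0 := gen0 x w y hR z hz
  have g0' := gen0 x w y hR z' hz'
  have g1 := gen1 x w y hR z hz hy
  have g1' := gen1 x w y hR z' hz' hy'
  have ey : ∑ i, (z' - y i)⁻¹ = ∑ i, (z - y i)⁻¹ + (z - z') * ∑ i, (z - y i)⁻¹ * (z' - y i)⁻¹ := by
    rw [mul_sum, ← sum_add_distrib]
    refine sum_congr rfl fun i _ => ?_
    field_simp [hy i, hy' i]; ring
  set Py := ∏ i, (z - y i)
  set Py' := ∏ i, (z' - y i)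
  set q := ∏ n, (z - x n)
  set q' := ∏ n, (z' - x n)
  -- expand RHS
  have hab : ∀ n, (z' - x n)⁻¹ = (z - x n)⁻¹ + (z - z') * ((z - x n)⁻¹ * (z' - x n)⁻¹) := by
    intro n; field_simp [hz n, hz' n]; ring
  have ex : ∑ i, (z' - x i)⁻¹ = ∑ i, (z - x i)⁻¹ + (z - z') * ∑ i, (z - x i)⁻¹ * (z' - x i)⁻¹ := by
    rw [mul_sum, ← sum_add_distrib]
    exact sum_congr rfl fun i _ => hab i
  have eQ : ∑ i, w i * (z' - x i)⁻¹ = ∑ i, w i * (z - x i)⁻¹ +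
      (z - z') * ∑ i, w i * ((z - x i)⁻¹ * (z' - x i)⁻¹) := by
    rw [mul_sum, ← sum_add_distrib]
    refine sum_congr rfl fun i _ => ?_
    field_simp [hz i, hz' i]; ring
  have eb2 : ∑ i, w i * (z' - x i)⁻¹ ^ 2 = ∑ i, w i * ((z - x i)⁻¹ * (z' - x i)⁻¹) +
      (z - z') * ∑ i, w i * ((z - x i)⁻¹ * (z' - x i)⁻¹ ^ 2) := by
    rw [mul_sum, ← sum_add_distrib]
    refine sum_congr rfl fun i _ => ?_
    field_simp [hz i, hz' i]; ring
  have ea2 : ∑ i, w i * (z - x i)⁻¹ ^ 2 = ∑ i, w i * ((z - x i)⁻¹ * (z' - x i)⁻¹) -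
      (z - z') * ∑ i, w i * ((z - x i)⁻¹ ^ 2 * (z' - x i)⁻¹) := by
    rw [mul_sum, ← sum_sub_distrib]
    refine sum_congr rfl fun i _ => ?_
    field_simp [hz i, hz' i]; ring
  have ejj : ∀ P Q : ℝ, ∑ j, ((z - x j)⁻¹ * (P - w j * (z - x j)⁻¹)) *
      ((z' - x j)⁻¹ * (Q - w j * (z' - x j)⁻¹)) = P * Q * ∑ i, (z - x i)⁻¹ * (z' - x i)⁻¹ -
      P * ∑ i, w i * ((z - x i)⁻¹ * (z' - x i)⁻¹ ^ 2) - Q * ∑ i, w i * ((z - x i)⁻¹ ^ 2 * (z' - x i)⁻¹) +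
      ∑ m, w m ^ 2 * ((z - x m)⁻¹ * (z' - x m)⁻¹) ^ 2 := by
    intro P Q
    simp only [mul_sum]
    rw [← sum_sub_distrib, ← sum_sub_distrib, ← sum_add_distrib]
    refine sum_congr rfl fun i _ => ?_
    ring
  rw [ejj]
  rw [ey, mul_add] at g1'
  rw [eQ, ex, eb2] at g1'
  rw [eQ] at g0' ⊢
  rw [ea2] at g1
  generalize (∑ i, (z - y i)⁻¹ * (z' - y i)⁻¹) = Tyy at *
  generalize (∑ i, (z - y i)⁻¹) = S1y at *
  generalize (∑ i, w i * (z - x i)⁻¹) = P at *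
  generalize (∑ i, w i * ((z - x i)⁻¹ * (z' - x i)⁻¹)) = T at *
  generalize (∑ i, (z - x i)⁻¹ * (z' - x i)⁻¹) = U at *
  generalize (∑ i, w i * ((z - x i)⁻¹ * (z' - x i)⁻¹ ^ 2)) = V1 at *
  generalize (∑ i, w i * ((z - x i)⁻¹ ^ 2 * (z' - x i)⁻¹)) = V2 at *
  generalize (∑ i, (z - x i)⁻¹) = A at *
  apply mul_left_cancel₀ hd
  have key : (z - z') * (Py * Py' * Tyy) = Py * (Py' * S1y + Py' * ((z - z') * Tyy)) - Py' * (Py * S1y) := by ring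
  rw [key, g1', g1, g0, g0']
  ring
end


theorem dd_aux {N : ℕ} (x : Fin N → ℝ) (hx : Function.Injective x) (z : ℝ) (hz : ∀ n, z - x n ≠ 0)
    (i j : Fin N) : ((z - x i)⁻¹ - (z - x j)⁻¹) * (x i - x j)⁻¹ =
      (z - x i)⁻¹ * (z - x j)⁻¹ - if i = j then (z - x i)⁻¹ ^ 2 else 0 := by
  split_ifs with h
  · subst h; simp [sq]
  · have : x i - x j ≠ 0 := sub_ne_zero.2 fun e => h (hx e)
    field_simp [hz i, hz j]; ring

theorem erase_full {N : ℕ} (x : Fin N → ℝ) (i : Fin N) :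
    ∑ j ∈ univ.erase i, (1 / (x i - x j)) = ∑ j, (x i - x j)⁻¹ := by
  simp only [one_div]
  exact sum_erase _ (by simp)

theorem pair_sum {N : ℕ} (x : Fin N → ℝ) (hx : Function.Injective x) (z : ℝ) (hz : ∀ n, z - x n ≠ 0) :
    ∑ i, ∑ j, (x i - x j)⁻¹ * (z - x i)⁻¹ =
      (1/2) * ((∑ i, (z - x i)⁻¹) ^ 2 - ∑ i, (z - x i)⁻¹ ^ 2) := by
  have h2 : ∑ i, ∑ j, (x i - x j)⁻¹ * (z - x i)⁻¹ = ∑ i, ∑ j, (x j - x i)⁻¹ * (z - x j)⁻¹ := sum_comm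
  have h3 : ∑ i, ∑ j, (x i - x j)⁻¹ * (z - x i)⁻¹ + ∑ i, ∑ j, (x j - x i)⁻¹ * (z - x j)⁻¹ =
      (∑ i, (z - x i)⁻¹) ^ 2 - ∑ i, (z - x i)⁻¹ ^ 2 := by
    rw [← sum_add_distrib, sq, sum_mul, ← sum_sub_distrib]
    refine sum_congr rfl fun i _ => ?_
    rw [← sum_add_distrib, mul_sum]
    have : (z - x i)⁻¹ ^ 2 = ∑ j, if i = j then (z - x i)⁻¹ ^ 2 else 0 := by simp
    rw [this, ← sum_sub_distrib]
    refine sum_congr rfl fun j _ => ?_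
    rw [← dd_aux x hx z hz, ← neg_sub (x i) (x j), inv_neg]
    ring
  linarith

theorem pair_w {N : ℕ} (x w : Fin N → ℝ) (hx : Function.Injective x) (z : ℝ) (hz : ∀ n, z - x n ≠ 0) :
    ∑ i, ∑ j, w i * (z - x i)⁻¹ * (((z - x i)⁻¹ - (z - x j)⁻¹) * (x i - x j)⁻¹) =
      (∑ i, (z - x i)⁻¹) * (∑ i, w i * (z - x i)⁻¹ ^ 2) - ∑ i, w i * (z - x i)⁻¹ ^ 3 := by
  rw [mul_sum, ← sum_sub_distrib]
  refine sum_congr rfl fun i _ => ?_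
  rw [← mul_sum]
  simp only [dd_aux x hx z hz]
  rw [sum_sub_distrib, ← mul_sum, sum_ite_eq]
  simp only [mem_univ, if_true]
  ring

theorem pair_D {N : ℕ} (x w : Fin N → ℝ) (hx : Function.Injective x) (z : ℝ) (hz : ∀ n, z - x n ≠ 0) :
    ∑ i, ∑ j, ((x i - x j) ^ 2)⁻¹ * (w j - w i) * ((z - x i)⁻¹ - (z - x j)⁻¹) =
    - 2 * ∑ i, ∑ j, w i * (z - x i)⁻¹ * ((z - x j)⁻¹ * (x i - x j)⁻¹) := by
  have h1 : ∑ i, ∑ j, ((x i - x j) ^ 2)⁻¹ * w j * ((z - x i)⁻¹ - (z - x j)⁻¹) =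
      ∑ i, ∑ j, ((x j - x i) ^ 2)⁻¹ * w i * ((z - x j)⁻¹ - (z - x i)⁻¹) := sum_comm
  have h2 : ∑ i, ∑ j, ((x i - x j) ^ 2)⁻¹ * (w j - w i) * ((z - x i)⁻¹ - (z - x j)⁻¹) =
      ∑ i, ∑ j, ((x i - x j) ^ 2)⁻¹ * w j * ((z - x i)⁻¹ - (z - x j)⁻¹) -
      ∑ i, ∑ j, ((x i - x j) ^ 2)⁻¹ * w i * ((z - x i)⁻¹ - (z - x j)⁻¹) := by
    simp only [← sum_sub_distrib]
    refine sum_congr rfl fun i _ => sum_congr rfl fun j _ => ?_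
    ring
  rw [h2, h1, ← sum_sub_distrib, mul_sum]
  refine sum_congr rfl fun i _ => ?_
  rw [← sum_sub_distrib, mul_sum]
  refine sum_congr rfl fun j _ => ?_
  have e : ((x j - x i) ^ 2)⁻¹ = ((x i - x j) ^ 2)⁻¹ := by rw [← neg_sub, neg_sq]
  have d := dd_aux x hx z hz i j
  have : ((x j - x i) ^ 2)⁻¹ * w i * ((z - x j)⁻¹ - (z - x i)⁻¹) -
      ((x i - x j) ^ 2)⁻¹ * w i * ((z - x i)⁻¹ - (z - x j)⁻¹) =
      -2 * w i * (x i - x j)⁻¹ * (((z - x i)⁻¹ - (z - x j)⁻¹) * (x i - x j)⁻¹) := by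
    rw [e, sq, mul_inv]; ring
  rw [this, d]
  split_ifs with h
  · subst h; simp
  · ring

section
variable {k : ℕ} (x w : Fin (k+1) → ℝ) (y : Fin k → ℝ)
  (hR : ∀ z, ∏ i, (z - y i) = ∑ m, w m * ∏ n ∈ univ.erase m, (z - x n))
include hR

theorem L_gen (θ : ℝ) (hx : Function.Injective x) (hyi : Function.Injective y)
    (z : ℝ) (hz : ∀ n, z - x n ≠ 0) (hy : ∀ n, z - y n ≠ 0) :
    ∑ i, (θ * ∑ j ∈ univ.erase i, (1 / (y i - y j)) - y i / 2) * (-((∏ i, (z - y i)) * (z - y i)⁻¹)) =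
    ∑ j, (θ * ∑ l ∈ univ.erase j, (1 / (x j - x l)) - x j / 2) *
      (-((∏ n, (z - x n)) * ((z - x j)⁻¹ * ((∑ m, w m * (z - x m)⁻¹) - w j * (z - x j)⁻¹)))) +
    ∑ m, ∑ m', (1/2) * ((x m - x m') ^ 2)⁻¹ * (θ * (w m' - w m)) *
      ((∏ n, (z - x n)) * ((z - x m)⁻¹ - (z - x m')⁻¹)) := by
  have g0 := gen0 x w y hR z hz
  have g1 := gen1 x w y hR z hz hy
  have g2 := gen2 x w y hR z hz hy
  simp only [erase_full]
  have py := pair_sum y hyi z hy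
  have px := pair_sum x hx z hz
  have pw := pair_w x w hx z hz
  have pD := pair_D x w hx z hz
  set Py := ∏ i, (z - y i)
  set q := ∏ n, (z - x n)
  set S := ∑ m, w m * (z - x m)⁻¹
  have l1 : ∑ i, (θ * ∑ j, (y i - y j)⁻¹ - y i / 2) * (-(Py * (z - y i)⁻¹)) =
      -θ * Py * (∑ i, ∑ j, (y i - y j)⁻¹ * (z - y i)⁻¹) + Py / 2 * (z * (∑ i, (z - y i)⁻¹) - k) := by
    have : (k : ℝ) = ∑ i : Fin k, 1 := by simp
    rw [this]
    simp only [← sum_mul]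
    rw [mul_sum, mul_sum, ← sum_sub_distrib, mul_sum, ← sum_add_distrib]
    refine sum_congr rfl fun i _ => ?_
    field_simp [hy i]; ring
  have l2 : ∑ j, (θ * ∑ l, (x j - x l)⁻¹ - x j / 2) *
      (-(q * ((z - x j)⁻¹ * (S - w j * (z - x j)⁻¹)))) =
      -θ * q * (S * (∑ i, ∑ j, (x i - x j)⁻¹ * (z - x i)⁻¹) -
        ∑ i, ∑ j, (w i * (z - x i)⁻¹ * ((z - x i)⁻¹ * (x i - x j)⁻¹))) +
      q / 2 * (z * (S * ∑ i, (z - x i)⁻¹) - z * (∑ i, w i * (z - x i)⁻¹ ^ 2) - k * S) := by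
    have e : (k : ℝ) * S = ∑ i : Fin (k+1), (S - w i * (z - x i)⁻¹) := by
      rw [sum_sub_distrib]; simp [S]; ring
    rw [e]
    simp only [← sum_mul, ← mul_sum]
    rw [mul_sum, mul_sum, mul_sum, mul_sum, ← sum_sub_distrib, ← sum_sub_distrib, ← sum_sub_distrib, mul_sum,
      mul_sum, ← sum_add_distrib]
    refine sum_congr rfl fun i _ => ?_
    field_simp [hz i]; ring
  have l3 : ∑ m, ∑ m', (1/2) * ((x m - x m') ^ 2)⁻¹ * (θ * (w m' - w m)) *
      (q * ((z - x m)⁻¹ - (z - x m')⁻¹)) = θ * q / 2 * 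
      ∑ i, ∑ j, ((x i - x j) ^ 2)⁻¹ * (w j - w i) * ((z - x i)⁻¹ - (z - x j)⁻¹) := by
    simp only [mul_sum]
    refine sum_congr rfl fun i _ => sum_congr rfl fun j _ => ?_
    ring
  have l4 : ∑ i, ∑ j, w i * (z - x i)⁻¹ * (((z - x i)⁻¹ - (z - x j)⁻¹) * (x i - x j)⁻¹) =
      ∑ i, ∑ j, (w i * (z - x i)⁻¹ * ((z - x i)⁻¹ * (x i - x j)⁻¹)) -
      ∑ i, ∑ j, w i * (z - x i)⁻¹ * ((z - x j)⁻¹ * (x i - x j)⁻¹) := by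
    simp only [← sum_sub_distrib]
    refine sum_congr rfl fun i _ => sum_congr rfl fun j _ => ?_
    ring
  rw [l1, l2, l3, py, px, pD]
  rw [l4] at pw
  linear_combination (-θ/2) * g2 + (z/2) * g1 - (k/2) * g0 - θ * q * pw
end


noncomputable def drift {m : ℕ} (θ : ℝ) (y : Fin m → ℝ) (i : Fin m) : ℝ :=
  θ * ∑ j ∈ univ.erase i, (1 / (y i - y j)) - y i / 2

noncomputable def DX (k : ℕ) : Fin (k+1) ⊕ (Fin (k+1) × Fin (k+1)) →
    Derivation ℝ (MvPolynomial (Fin (k+1) ⊕ Fin (k+1)) ℝ) (MvPolynomial (Fin (k+1) ⊕ Fin (k+1)) ℝ) :=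
  Sum.elim (fun j => MvPolynomial.pderiv (Sum.inl j))
    (fun p => MvPolynomial.pderiv (Sum.inr p.1) - MvPolynomial.pderiv (Sum.inr p.2))

noncomputable def cX {k : ℕ} (x w : Fin (k+1) → ℝ) : Fin (k+1) ⊕ (Fin (k+1) × Fin (k+1)) → ℝ :=
  Sum.elim (fun _ => 1/2) (fun p => (1/2) * ((x p.1 - x p.2) ^ 2)⁻¹ * (w p.1 * w p.2))

noncomputable def eX {k : ℕ} (θ : ℝ) (x w : Fin (k+1) → ℝ) : Fin (k+1) ⊕ (Fin (k+1) × Fin (k+1)) → ℝ :=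
  Sum.elim (drift θ x) (fun p => (1/2) * ((x p.1 - x p.2) ^ 2)⁻¹ * (θ * (w p.2 - w p.1)))

section
variable {k : ℕ} (x w : Fin (k+1) → ℝ) (y : Fin k → ℝ)

theorem ev_pY (z : ℝ) : MvPolynomial.aeval y (pY k z) = ∏ i, (z - y i) := by
  simp [pY, map_prod]

theorem ev_qX (z : ℝ) (m : Fin (k+1)) : MvPolynomial.aeval (Sum.elim x w) (qX k z m) =
    ∏ n ∈ univ.erase m, (z - x n) := by
  simp [qX, map_prod]

theorem ev_pX (z : ℝ) : MvPolynomial.aeval (Sum.elim x w) (pX k z) =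
    ∑ m, w m * ∏ n ∈ univ.erase m, (z - x n) := by
  simp only [pX, map_sum, map_mul, ev_qX, MvPolynomial.aeval_X, Sum.elim_inr]

theorem ev_dpY (z : ℝ) (i : Fin k) : MvPolynomial.aeval y (MvPolynomial.pderiv i (pY k z)) =
    -∏ n ∈ univ.erase i, (z - y n) := by
  simp [pderiv_pY, map_prod]

theorem ev_dpX (z : ℝ) (j : Fin (k+1)) :
    MvPolynomial.aeval (Sum.elim x w) (MvPolynomial.pderiv (Sum.inl j) (pX k z)) =
    ∑ m, w m * if j = m then 0 else -∏ n ∈ (univ.erase m).erase j, (z - x n) := by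
  rw [pderiv_pX, map_sum]
  refine sum_congr rfl fun m _ => ?_
  rw [pderiv_qX]
  split_ifs <;> simp [map_prod]

theorem ev_dpX_gen (z : ℝ) (hz : ∀ n, z - x n ≠ 0) (j : Fin (k+1)) :
    MvPolynomial.aeval (Sum.elim x w) (MvPolynomial.pderiv (Sum.inl j) (pX k z)) =
    -((∏ n, (z - x n)) * ((z - x j)⁻¹ * ((∑ m, w m * (z - x m)⁻¹) - w j * (z - x j)⁻¹))) := by
  rw [ev_dpX]
  have : w j * (z - x j)⁻¹ = ∑ m, if j = m then w m * (z - x m)⁻¹ else 0 := by simp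
  rw [this, ← sum_sub_distrib, mul_sum, mul_sum, ← sum_neg_distrib]
  refine sum_congr rfl fun m _ => ?_
  split_ifs with h
  · simp
  · rw [prod_erase_inv x z hz _ _ (mem_erase.2 ⟨h, mem_univ j⟩), prod_erase_inv x z hz _ _ (mem_univ m)]
    ring

theorem Lop_pY (θ z : ℝ) : Lop (MvPolynomial.aeval y) (fun i => MvPolynomial.pderiv i) (fun _ => 1/2)
    (drift θ y) (pY k z) = ∑ i, drift θ y i * (-∏ n ∈ univ.erase i, (z - y n)) := by
  unfold Lop
  refine sum_congr rfl fun i _ => ?_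
  rw [pderiv2_pY, ev_dpY]; simp

theorem Lop_pX (θ z : ℝ) : Lop (MvPolynomial.aeval (Sum.elim x w)) (DX k) (cX x w) (eX θ x w) (pX k z) =
    ∑ j, drift θ x j * (∑ m, w m * if j = m then 0 else -∏ n ∈ (univ.erase m).erase j, (z - x n)) +
    ∑ m, ∑ m', (1/2) * ((x m - x m') ^ 2)⁻¹ * (θ * (w m' - w m)) *
      (∏ n ∈ univ.erase m, (z - x n) - ∏ n ∈ univ.erase m', (z - x n)) := by
  unfold Lop
  rw [Fintype.sum_sum_type, Fintype.sum_prod_type]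
  congr 1
  · refine sum_congr rfl fun i _ => ?_
    simp only [DX, Sum.elim_inl, cX, eX]
    rw [pderiv2_pX, ev_dpX]; simp
  · refine sum_congr rfl fun m _ => sum_congr rfl fun m' _ => ?_
    simp only [DX, Sum.elim_inr, cX, eX, Derivation.sub_apply, pderivr_pX, map_sub, pderivr_qX, ev_qX]
    simp

theorem Gam_pY (z z' : ℝ) : Gam (MvPolynomial.aeval y) (fun i => MvPolynomial.pderiv i) (fun _ => 1/2)
    (pY k z) (pY k z') = ∑ i, (∏ n ∈ univ.erase i, (z - y n)) * (∏ n ∈ univ.erase i, (z' - y n)) := by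
  unfold Gam
  refine sum_congr rfl fun i _ => ?_
  rw [ev_dpY, ev_dpY]; simp

theorem Gam_pX (z z' : ℝ) : Gam (MvPolynomial.aeval (Sum.elim x w)) (DX k) (cX x w) (pX k z) (pX k z') =
    ∑ j, (∑ m, w m * if j = m then 0 else -∏ n ∈ (univ.erase m).erase j, (z - x n)) *
      (∑ m, w m * if j = m then 0 else -∏ n ∈ (univ.erase m).erase j, (z' - x n)) +
    ∑ m, ∑ m', ((x m - x m') ^ 2)⁻¹ * (w m * w m') *
      (∏ n ∈ univ.erase m, (z - x n) - ∏ n ∈ univ.erase m', (z - x n)) *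
      (∏ n ∈ univ.erase m, (z' - x n) - ∏ n ∈ univ.erase m', (z' - x n)) := by
  unfold Gam
  rw [Fintype.sum_sum_type, Fintype.sum_prod_type]
  congr 1
  · refine sum_congr rfl fun i _ => ?_
    simp only [DX, Sum.elim_inl, cX]
    rw [ev_dpX, ev_dpX]; ring
  · refine sum_congr rfl fun m _ => sum_congr rfl fun m' _ => ?_
    simp only [DX, Sum.elim_inr, cX, Derivation.sub_apply, pderivr_pX, map_sub, ev_qX]
    ring

variable (hR : ∀ z, ∏ i, (z - y i) = ∑ m, w m * ∏ n ∈ univ.erase m, (z - x n))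
include hR

theorem Lop_p_eq (θ z : ℝ) (hx : Function.Injective x) (hy : Function.Injective y) :
    Lop (MvPolynomial.aeval y) (fun i => MvPolynomial.pderiv i) (fun _ => 1/2) (drift θ y) (pY k z) =
    Lop (MvPolynomial.aeval (Sum.elim x w)) (DX k) (cX x w) (eX θ x w) (pX k z) := by
  have hd : Dense ((Set.range x ∪ Set.range y)ᶜ) :=
    (((Set.finite_range x).union (Set.finite_range y)).countable).dense_compl ℝ
  revert z
  apply congrFun
  refine Continuous.ext_on hd ?_ ?_ ?_
  · simp only [Lop_pY]; fun_prop
  · simp only [Lop_pX]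
    refine Continuous.add ?_ (by fun_prop)
    refine continuous_finsetSum _ fun i _ => Continuous.mul (by fun_prop) ?_
    refine continuous_finsetSum _ fun m _ => Continuous.mul (by fun_prop) ?_
    split_ifs <;> fun_prop
  · intro z hz
    have hzx : ∀ n, z - x n ≠ 0 := fun n h => hz (Or.inl ⟨n, (sub_eq_zero.1 h).symm⟩)
    have hzy : ∀ n, z - y n ≠ 0 := fun n h => hz (Or.inr ⟨n, (sub_eq_zero.1 h).symm⟩)
    have := L_gen x w y hR θ hx hy z hzx hzy
    simp only [Lop_pY, Lop_pX]
    simp only [← ev_dpX x w z, ev_dpX_gen x w z hzx]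
    simp only [fun i => prod_erase_inv y z hzy univ i (mem_univ i),
      fun i => prod_erase_inv x z hzx univ i (mem_univ i), ← mul_sub]
    exact this

theorem Gam_p_eq (z z' : ℝ) (hx : Function.Injective x) :
    Gam (MvPolynomial.aeval y) (fun i => MvPolynomial.pderiv i) (fun _ => 1/2) (pY k z) (pY k z') =
    Gam (MvPolynomial.aeval (Sum.elim x w)) (DX k) (cX x w) (pX k z) (pX k z') := by
  have hfin : (Set.range x ∪ Set.range y).Finite := (Set.finite_range x).union (Set.finite_range y)
  have hgen : ∀ z z', z ∈ (Set.range x ∪ Set.range y)ᶜ → z' ∈ ((Set.range x ∪ Set.range y) ∪ {z})ᶜ →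
      Gam (MvPolynomial.aeval y) (fun i => MvPolynomial.pderiv i) (fun _ => 1/2) (pY k z) (pY k z') =
      Gam (MvPolynomial.aeval (Sum.elim x w)) (DX k) (cX x w) (pX k z) (pX k z') := by
    intro z z' hz hz'
    have hzx : ∀ n, z - x n ≠ 0 := fun n h => hz (Or.inl ⟨n, (sub_eq_zero.1 h).symm⟩)
    have hzy : ∀ n, z - y n ≠ 0 := fun n h => hz (Or.inr ⟨n, (sub_eq_zero.1 h).symm⟩)
    have hzx' : ∀ n, z' - x n ≠ 0 := fun n h => hz' (Or.inl (Or.inl ⟨n, (sub_eq_zero.1 h).symm⟩))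
    have hzy' : ∀ n, z' - y n ≠ 0 := fun n h => hz' (Or.inl (Or.inr ⟨n, (sub_eq_zero.1 h).symm⟩))
    have hzz : z ≠ z' := fun h => hz' (Or.inr h.symm)
    have := gamma_gen x w y hR z z' hzx hzy hzx' hzy' hzz
    simp only [Gam_pY, Gam_pX]
    simp only [← ev_dpX x w z, ← ev_dpX x w z', ev_dpX_gen x w z hzx, ev_dpX_gen x w z' hzx']
    simp only [fun i => prod_erase_inv y z hzy univ i (mem_univ i),
      fun i => prod_erase_inv x z hzx univ i (mem_univ i),
      fun i => prod_erase_inv y z' hzy' univ i (mem_univ i),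
      fun i => prod_erase_inv x z' hzx' univ i (mem_univ i), ← mul_sub]
    have e1 : ∑ i, (∏ i, (z - y i)) * (z - y i)⁻¹ * ((∏ i, (z' - y i)) * (z' - y i)⁻¹) =
        (∏ i, (z - y i)) * (∏ i, (z' - y i)) * ∑ i, (z - y i)⁻¹ * (z' - y i)⁻¹ := by
      rw [mul_sum]
      exact sum_congr rfl fun i _ => by ring
    rw [e1, this, mul_add]
    congr 1
    · rw [mul_sum]
      exact sum_congr rfl fun i _ => by ring
    · rw [sq, sum_mul, ← sum_sub_distrib, mul_sum]
      refine sum_congr rfl fun m _ => ?_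
      rw [mul_sum]
      have : w m ^ 2 * ((z - x m)⁻¹ * (z' - x m)⁻¹) ^ 2 =
          ∑ j, if m = j then w m ^ 2 * ((z - x m)⁻¹ * (z' - x m)⁻¹) ^ 2 else 0 := by simp
      rw [this, ← sum_sub_distrib, mul_sum]
      refine sum_congr rfl fun j _ => ?_
      split_ifs with h
      · subst h; simp; right; ring
      · have h1 := dd_aux x hx z hzx m j
        have h2 := dd_aux x hx z' hzx' m j
        rw [if_neg h, sub_zero] at h1 h2
        calc _ = (∏ n, (z - x n)) * (∏ n, (z' - x n)) * (w m * w j) * 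
            (((z - x m)⁻¹ * (z - x j)⁻¹) * ((z' - x m)⁻¹ * (z' - x j)⁻¹)) := by ring
          _ = _ := by rw [← h1, ← h2, sq, mul_inv]; ring
  have hcY : ∀ z, Continuous fun z' => Gam (MvPolynomial.aeval y) (fun i => MvPolynomial.pderiv i)
      (fun _ => 1/2) (pY k z) (pY k z') := by
    intro z; simp only [Gam_pY]; fun_prop
  have hcX : ∀ z, Continuous fun z' => 
      Gam (MvPolynomial.aeval (Sum.elim x w)) (DX k) (cX x w) (pX k z) (pX k z') := by
    intro z; simp only [Gam_pX]
    refine Continuous.add ?_ (by fun_prop)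
    refine continuous_finsetSum _ fun i _ => Continuous.mul (by fun_prop) ?_
    refine continuous_finsetSum _ fun m _ => Continuous.mul (by fun_prop) ?_
    split_ifs <;> fun_prop
  have hsY : ∀ f g, Gam (MvPolynomial.aeval y) (fun i => MvPolynomial.pderiv i) (fun _ => 1/2) f g =
      Gam (MvPolynomial.aeval y) (fun i => MvPolynomial.pderiv i) (fun _ => 1/2) g f :=
    fun f g => sum_congr rfl fun _ _ => by ring
  have hsX : ∀ f g, Gam (MvPolynomial.aeval (Sum.elim x w)) (DX k) (cX x w) f g =
      Gam (MvPolynomial.aeval (Sum.elim x w)) (DX k) (cX x w) g f :=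
    fun f g => sum_congr rfl fun _ _ => by ring
  have hg2 : ∀ z ∈ (Set.range x ∪ Set.range y)ᶜ, ∀ z', 
      Gam (MvPolynomial.aeval y) (fun i => MvPolynomial.pderiv i) (fun _ => 1/2) (pY k z) (pY k z') =
      Gam (MvPolynomial.aeval (Sum.elim x w)) (DX k) (cX x w) (pX k z) (pX k z') := by
    intro z hz
    apply congrFun
    exact Continuous.ext_on ((hfin.union (Set.finite_singleton z)).countable.dense_compl ℝ) (hcY z) (hcX z)
      fun z' hz' => hgen z z' hz hz'
  rw [hsY, hsX]
  revert z
  apply congrFun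
  exact Continuous.ext_on (hfin.countable.dense_compl ℝ) (hcY z') (hcX z') fun z hz => by
    change Gam _ _ _ _ _ = Gam _ _ _ _ _
    rw [hsY, hsX]; exact hg2 z hz z'

theorem point_identity (θ : ℝ) (hx : Function.Injective x) (hy : Function.Injective y)
    (F : MvPolynomial ℝ ℝ) :
    Lop (MvPolynomial.aeval y) (fun i => MvPolynomial.pderiv i) (fun _ => 1/2) (drift θ y)
      (MvPolynomial.aeval (pY k) F) =
    Lop (MvPolynomial.aeval (Sum.elim x w)) (DX k) (cX x w) (eX θ x w) (MvPolynomial.aeval (pX k) F) :=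
  chain _ _ _ _ _ _ _ _ _ _ (fun z => by rw [ev_pY, ev_pX, hR]) (fun z z' => Gam_p_eq x w y hR z z' hx)
    (fun z => Lop_p_eq x w y hR θ z hx hy) F

theorem point_eval (F : MvPolynomial ℝ ℝ) :
    MvPolynomial.aeval y (MvPolynomial.aeval (pY k) F) =
      MvPolynomial.aeval (Sum.elim x w) (MvPolynomial.aeval (pX k) F) := by
  have : (MvPolynomial.aeval y).comp (MvPolynomial.aeval (pY k)) =
      (MvPolynomial.aeval (Sum.elim x w)).comp (MvPolynomial.aeval (pX k)) := by
    apply MvPolynomial.algHom_ext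
    intro z
    simp only [AlgHom.comp_apply, MvPolynomial.aeval_X]
    rw [ev_pY, ev_pX, hR]
  exact congrArg (fun g => g F) this
end


theorem hasFDerivAt_eval {m : ℕ} (f : MvPolynomial (Fin m) ℝ) (z : Fin m → ℝ) :
    HasFDerivAt (fun z => MvPolynomial.eval z f)
      (∑ i, (MvPolynomial.eval z (MvPolynomial.pderiv i f)) • (ContinuousLinearMap.proj i : (Fin m → ℝ) →L[ℝ] ℝ)) z := by
  induction f using MvPolynomial.induction_on with
  | C a => simp; exact hasFDerivAt_const _ _
  | add f g hf hg =>
    simp only [map_add, add_smul, sum_add_distrib]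
    exact hf.add hg
  | mul_X f j hf =>
    have hj : HasFDerivAt (fun z : Fin m → ℝ => z j) (ContinuousLinearMap.proj j : (Fin m → ℝ) →L[ℝ] ℝ) z :=
      (ContinuousLinearMap.proj j : (Fin m → ℝ) →L[ℝ] ℝ).hasFDerivAt
    have := hf.mul hj
    simp only [map_mul, MvPolynomial.eval_X]
    refine this.congr_fderiv ?_
    ext v
    have e : ∀ x, MvPolynomial.eval z (MvPolynomial.pderiv x (f * MvPolynomial.X j)) * v x =
        (if j = x then MvPolynomial.eval z f * v x else 0) +
          z j * (MvPolynomial.eval z (MvPolynomial.pderiv x f) * v x) := by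
      intro x
      rw [Derivation.leibniz, MvPolynomial.pderiv_X, Pi.single_apply]
      by_cases h : j = x
      · simp [h]; ring
      · simp [h, Ne.symm h, mul_assoc]
    simp only [_root_.add_apply, _root_.smul_apply, _root_.sum_apply,
      ContinuousLinearMap.proj_apply, smul_eq_mul]
    simp_rw [e]
    rw [sum_add_distrib, ← mul_sum]
    simp

theorem pd_eval {m : ℕ} (f : MvPolynomial (Fin m) ℝ) (i : Fin m) (z : Fin m → ℝ) :
    pd (fun z => MvPolynomial.eval z f) i z = MvPolynomial.eval z (MvPolynomial.pderiv i f) := by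
  unfold pd
  rw [(hasFDerivAt_eval f z).fderiv]
  simp [Pi.single_apply]

theorem pd2_eval {m : ℕ} (f : MvPolynomial (Fin m) ℝ) (i : Fin m) (z : Fin m → ℝ) :
    pd2 (fun z => MvPolynomial.eval z f) i z =
      MvPolynomial.eval z (MvPolynomial.pderiv i (MvPolynomial.pderiv i f)) := by
  have := pd_eval (MvPolynomial.pderiv i f) i z
  rw [← this]
  have h : (fun z => MvPolynomial.eval z (MvPolynomial.pderiv i f)) = 
    fun w => fderiv ℝ (fun z => MvPolynomial.eval z f) w (Pi.single i 1) := by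
    funext w
    exact (pd_eval f i w).symm
  rw [h]; rfl

theorem genOU_eval {m : ℕ} (θ : ℝ) (f : MvPolynomial (Fin m) ℝ) (z : Fin m → ℝ) :
    genOU θ (fun z => MvPolynomial.eval z f) z =
      Lop (MvPolynomial.aeval z) (fun i => MvPolynomial.pderiv i) (fun _ => 1/2) (drift θ z) f := by
  unfold genOU genA Lop drift
  simp only [pd_eval, pd2_eval]
  rw [mul_sum, mul_sum, mul_sum, ← sum_add_distrib, ← sum_sub_distrib]
  refine sum_congr rfl fun i _ => ?_
  rw [← sum_mul]; 
  change _ = 1 / 2 * MvPolynomial.eval z _ + _ * MvPolynomial.eval z _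
  ring

theorem mem_range_pY_coeff (k : ℕ) (n : ℕ) :
    (∏ i : Fin k, (Polynomial.X - Polynomial.C (MvPolynomial.X i : MvPolynomial (Fin k) ℝ))).coeff n ∈
      (MvPolynomial.aeval (R := ℝ) (pY k)).range := by
  classical
  set p : Polynomial (MvPolynomial (Fin k) ℝ) := 
    ∏ i : Fin k, (Polynomial.X - Polynomial.C (MvPolynomial.X i : MvPolynomial (Fin k) ℝ)) with hp
  have hdeg : p.natDegree < k + 1 := by
    rw [hp, Polynomial.natDegree_finsetProd_X_sub_C_eq_card]; simp
  have hval : ∀ s : Fin (k+1), ∑ n : Fin (k+1), ((s : ℕ) : ℝ) ^ (n:ℕ) • p.coeff n = pY k ((s:ℕ):ℝ) := by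
    intro s
    have : Polynomial.eval (MvPolynomial.C ((s:ℕ):ℝ)) p = pY k ((s:ℕ):ℝ) := by
      rw [hp, Polynomial.eval_prod]; simp [pY]
    rw [← this, Polynomial.eval_eq_sum_range' hdeg, Finset.sum_range]
    refine sum_congr rfl fun n _ => ?_
    rw [Algebra.smul_def, MvPolynomial.algebraMap_eq, map_pow, mul_comm]
  set V := Matrix.vandermonde (fun s : Fin (k+1) => ((s:ℕ):ℝ)) with hV
  have hdet : IsUnit V.det := by
    rw [isUnit_iff_ne_zero, hV, Matrix.det_vandermonde_ne_zero_iff]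
    intro a b h
    simp only [Nat.cast_inj] at h
    exact Fin.ext h
  by_cases hn : n < k + 1
  · have key : p.coeff n = ∑ s, (V⁻¹ ⟨n, hn⟩ s) • pY k ((s:ℕ):ℝ) := by
      simp_rw [← hval, smul_sum, smul_smul]
      rw [sum_comm]
      simp_rw [← sum_smul]
      have h2 : ∀ m : Fin (k+1), ∑ s : Fin (k+1), V⁻¹ ⟨n, hn⟩ s * ((s:ℕ):ℝ) ^ (m:ℕ) = 
          (1 : Matrix (Fin (k+1)) (Fin (k+1)) ℝ) ⟨n, hn⟩ m := by
        intro m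
        rw [← Matrix.nonsing_inv_mul V hdet, Matrix.mul_apply]
        rfl
      simp_rw [h2, Matrix.one_apply, ite_smul, one_smul, zero_smul]
      simp
    rw [key]
    refine Subalgebra.sum_mem _ fun s _ => Subalgebra.smul_mem _ ?_ _
    exact ⟨MvPolynomial.X ((s:ℕ):ℝ), by simp⟩
  · rw [Polynomial.coeff_eq_zero_of_natDegree_lt (by omega)]
    exact Subalgebra.zero_mem _

theorem symm_range (k : ℕ) (f : MvPolynomial (Fin k) ℝ) (hf : f.IsSymmetric) :
    ∃ F : MvPolynomial ℝ ℝ, MvPolynomial.aeval (pY k) F = f := by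
  have hes : ∀ n, n ≤ k → MvPolynomial.esymm (Fin k) ℝ n ∈ (MvPolynomial.aeval (R := ℝ) (pY k)).range := by
    intro n hn
    have h := mem_range_pY_coeff k (k - n)
    have h2 := Multiset.prod_X_sub_C_coeff (univ.val.map (fun i : Fin k => (MvPolynomial.X i : MvPolynomial (Fin k) ℝ)))
      (k := k - n) (by simp)
    rw [Multiset.map_map] at h2
    change (∏ i : Fin k, (Polynomial.X - Polynomial.C (MvPolynomial.X i : MvPolynomial (Fin k) ℝ))).coeff (k-n) = _ at h2
    rw [h2] at h
    simp only [Multiset.card_map, Finset.card_val, Finset.card_univ, Fintype.card_fin] at h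
    rw [Nat.sub_sub_self hn] at h
    rw [MvPolynomial.esymm_eq_multiset_esymm]
    have h3 := Subalgebra.smul_mem _ h ((-1:ℝ)^n)
    convert h3 using 1
    rw [Algebra.smul_def]
    simp [← mul_assoc, ← mul_pow]
  have := MvPolynomial.esymmAlgHom_fin_surjective ℝ (n := k) (m := k) le_rfl ⟨f, hf⟩
  obtain ⟨G, hG⟩ := this
  have hG' : MvPolynomial.aeval (fun i : Fin k => MvPolynomial.esymm (Fin k) ℝ (i+1)) G = f := by
    rw [← MvPolynomial.esymmAlgHom_apply, hG]
  rw [← hG']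
  have hle : (MvPolynomial.aeval (R := ℝ) (fun i : Fin k => MvPolynomial.esymm (Fin k) ℝ (i+1))).range ≤
      (MvPolynomial.aeval (R := ℝ) (pY k)).range := by
    rw [← Algebra.adjoin_range_eq_range_aeval, Algebra.adjoin_le_iff]
    rintro _ ⟨i, rfl⟩
    exact hes _ i.2
  exact hle ⟨G, rfl⟩


noncomputable def Den {k : ℕ} (x : Fin (k+1) → ℝ) (j : Fin (k+1)) : ℝ :=
  ∏ i : Fin k, (x j - x (j.succAbove i))

noncomputable def Phi {k : ℕ} (x : Fin (k+1) → ℝ) (y : Fin k → ℝ) (j : Fin (k+1)) : ℝ :=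
  (∏ i : Fin k, (x j - y i)) / Den x j

def Wo {k : ℕ} (x : Fin (k+1) → ℝ) : Set (Fin k → ℝ) :=
  {y | ∀ i : Fin k, x i.castSucc < y i ∧ y i < x i.succ}

theorem prod_erase_succAbove {k : ℕ} (m : Fin (k+1)) (f : Fin (k+1) → ℝ) :
    ∏ n ∈ univ.erase m, f n = ∏ i : Fin k, f (m.succAbove i) := by
  have h : univ.erase m = univ.map (Fin.succAboveEmb m) := by
    ext n
    simp only [mem_erase, mem_univ, and_true, mem_map, true_and]
    constructor
    · intro h
      obtain ⟨i, hi⟩ := Fin.exists_succAbove_eq h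
      exact ⟨i, hi⟩
    · rintro ⟨i, rfl⟩
      exact Fin.succAbove_ne _ _
  rw [h, prod_map]; rfl

theorem Den_ne {k : ℕ} {x : Fin (k+1) → ℝ} (hx : Function.Injective x) (j : Fin (k+1)) : Den x j ≠ 0 := by
  unfold Den
  refine prod_ne_zero_iff.2 fun i _ h => ?_
  exact Fin.succAbove_ne j i (hx (sub_eq_zero.1 h)).symm

noncomputable def Rpol {k : ℕ} (x w : Fin (k+1) → ℝ) : Polynomial ℝ :=
  ∑ m, Polynomial.C (w m) * ∏ n ∈ univ.erase m, (Polynomial.X - Polynomial.C (x n))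

theorem Rpol_eval {k : ℕ} (x w : Fin (k+1) → ℝ) (z : ℝ) :
    (Rpol x w).eval z = ∑ m, w m * ∏ n ∈ univ.erase m, (z - x n) := by
  simp [Rpol, Polynomial.eval_finsetSum, Polynomial.eval_prod]

theorem Rpol_eval_x {k : ℕ} (x w : Fin (k+1) → ℝ) (j : Fin (k+1)) :
    (Rpol x w).eval (x j) = w j * Den x j := by
  rw [Rpol_eval, sum_eq_single j]
  · rw [prod_erase_succAbove]; rfl
  · intro m _ hm
    rw [prod_eq_zero (i := j) (by simp [hm.symm]) (by simp), mul_zero]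
  · simp

theorem Rpol_degree {k : ℕ} (x w : Fin (k+1) → ℝ) : (Rpol x w).degree < (k+1 : ℕ) := by
  refine lt_of_le_of_lt (Polynomial.degree_sum_le _ _) ?_
  rw [Finset.sup_lt_iff (WithBot.bot_lt_coe _)]
  intro m _
  refine lt_of_le_of_lt (Polynomial.degree_mul_le _ _) ?_
  have h1 : (Polynomial.C (w m)).degree ≤ 0 := Polynomial.degree_C_le
  have h2 : (∏ n ∈ univ.erase m, (Polynomial.X - Polynomial.C (x n))).degree = ((k:ℕ) : WithBot ℕ) := by
    rw [Polynomial.degree_prod]; simp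
  rw [h2]
  calc _ ≤ (0 : WithBot ℕ) + (k:ℕ) := by gcongr
    _ < _ := by rw [zero_add]; exact_mod_cast Nat.lt_succ_self k

theorem Rpol_coeff {k : ℕ} (x w : Fin (k+1) → ℝ) : (Rpol x w).coeff k = ∑ m, w m := by
  unfold Rpol
  rw [Polynomial.finsetSum_coeff]
  refine sum_congr rfl fun m _ => ?_
  rw [Polynomial.coeff_C_mul]
  have h := Polynomial.monic_prod_X_sub_C x (univ.erase m)
  have h2 : (∏ n ∈ univ.erase m, (Polynomial.X - Polynomial.C (x n))).natDegree = k := by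
    rw [Polynomial.natDegree_finsetProd_X_sub_C_eq_card]; simp
  have := h.coeff_natDegree
  rw [h2] at this
  rw [this, mul_one]

noncomputable def Ypol {k : ℕ} (y : Fin k → ℝ) : Polynomial ℝ :=
  ∏ i, (Polynomial.X - Polynomial.C (y i))

theorem Ypol_eval {k : ℕ} (y : Fin k → ℝ) (z : ℝ) : (Ypol y).eval z = ∏ i, (z - y i) := by
  simp [Ypol, Polynomial.eval_prod]

theorem Ypol_degree {k : ℕ} (y : Fin k → ℝ) : (Ypol y).degree = (k : ℕ) := by
  rw [Ypol, Polynomial.degree_prod]; simp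

theorem Ypol_coeff {k : ℕ} (y : Fin k → ℝ) : (Ypol y).coeff k = 1 := by
  have h : (Ypol y).Monic := Polynomial.monic_prod_X_sub_C y univ
  have h2 : (Ypol y).natDegree = k := by
    rw [Ypol, Polynomial.natDegree_finsetProd_X_sub_C_eq_card]; simp
  have := h.coeff_natDegree
  rwa [h2] at this

theorem Ypol_eq_Rpol {k : ℕ} {x : Fin (k+1) → ℝ} (hx : Function.Injective x) (y : Fin k → ℝ) :
    Ypol y = Rpol x (Phi x y) := by
  refine Polynomial.eq_of_degrees_lt_of_eval_index_eq univ (v := x) hx.injOn ?_ ?_ ?_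
  · rw [Ypol_degree]; simp
    exact_mod_cast Nat.lt_succ_self k
  · simpa using Rpol_degree x (Phi x y)
  · intro j _
    rw [Rpol_eval_x, Ypol_eval, Phi, div_mul_cancel₀ _ (Den_ne hx j)]

theorem Phi_sum {k : ℕ} {x : Fin (k+1) → ℝ} (hx : Function.Injective x) (y : Fin k → ℝ) :
    ∑ j, Phi x y j = 1 := by
  rw [← Rpol_coeff x, ← Ypol_eq_Rpol hx, Ypol_coeff]

theorem Phi_hR {k : ℕ} {x : Fin (k+1) → ℝ} (hx : Function.Injective x) (y : Fin k → ℝ) (z : ℝ) :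
    ∏ i, (z - y i) = ∑ m, Phi x y m * ∏ n ∈ univ.erase m, (z - x n) := by
  rw [← Rpol_eval, ← Ypol_eq_Rpol hx, Ypol_eval]

theorem Wo_strictMono {k : ℕ} {x : Fin (k+1) → ℝ} (hx : StrictMono x) {y : Fin k → ℝ} (hy : y ∈ Wo x) :
    StrictMono y := by
  intro i j hij
  exact ((hy i).2.trans_le (hx.monotone (by simpa [Fin.le_def] using hij))).trans (hy j).1

theorem factor_pos {k : ℕ} {x : Fin (k+1) → ℝ} (hx : StrictMono x) {y : Fin k → ℝ} (hy : y ∈ Wo x)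
    (j : Fin (k+1)) (i : Fin k) : 0 < (x j - y i) * (x j - x (j.succAbove i)) := by
  rcases lt_or_ge i.castSucc j with h | h
  · rw [Fin.succAbove_of_castSucc_lt _ _ h]
    have h1 : x i.castSucc < x j := hx h
    have h2 : x i.succ ≤ x j := hx.monotone (Fin.le_def.2 (by simpa [Fin.lt_def] using h))
    have := (hy i).2
    exact mul_pos (by linarith) (by linarith)
  · rw [Fin.succAbove_of_le_castSucc _ _ h]
    have h1 : x j ≤ x i.castSucc := hx.monotone h
    have := hy i
    exact mul_pos_of_neg_of_neg (by linarith) (by linarith)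

theorem Phi_pos {k : ℕ} {x : Fin (k+1) → ℝ} (hx : StrictMono x) {y : Fin k → ℝ} (hy : y ∈ Wo x)
    (j : Fin (k+1)) : 0 < Phi x y j := by
  unfold Phi Den
  rw [← prod_div_distrib]
  refine prod_pos fun i _ => ?_
  exact div_pos_iff_of_pos_mul hx hy j i
where
  div_pos_iff_of_pos_mul (hx : StrictMono x) (hy : y ∈ Wo x) (j : Fin (k+1)) (i : Fin k) :
      0 < (x j - y i) / (x j - x (j.succAbove i)) := by
    have := factor_pos hx hy j i
    rw [div_eq_mul_inv]
    rcases mul_pos_iff.1 this with ⟨a, b⟩ | ⟨a, b⟩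
    · exact mul_pos a (inv_pos.2 b)
    · exact mul_pos_of_neg_of_neg a (inv_lt_zero.2 b)

theorem Phi_inj {k : ℕ} {x : Fin (k+1) → ℝ} (hx : StrictMono x) {y y' : Fin k → ℝ} (hy : y ∈ Wo x)
    (hy' : y' ∈ Wo x) (h : Phi x y = Phi x y') : y = y' := by
  have hp : Ypol y = Ypol y' := by rw [Ypol_eq_Rpol hx.injective, Ypol_eq_Rpol hx.injective, h]
  funext i
  have h0 : (Ypol y).eval (y i) = 0 := by
    rw [Ypol_eval]; exact prod_eq_zero (mem_univ i) (by simp)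
  rw [hp, Ypol_eval, prod_eq_zero_iff] at h0
  obtain ⟨l, _, hl⟩ := h0
  have hl := sub_eq_zero.1 hl
  rcases lt_trichotomy i l with hil | hil | hil
  · have : x i.succ ≤ x l.castSucc := hx.monotone (by simpa [Fin.le_def] using hil)
    linarith [(hy i).2, (hy' l).1]
  · rw [hl, hil]
  · have : x l.succ ≤ x i.castSucc := hx.monotone (by simpa [Fin.le_def] using hil)
    linarith [(hy i).1, (hy' l).2]

theorem Den_sign {k : ℕ} {x : Fin (k+1) → ℝ} (hx : StrictMono x) (i : Fin k) :
    Den x i.castSucc * Den x i.succ < 0 := by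
  unfold Den
  rw [← prod_mul_distrib, ← mul_prod_erase _ _ (mem_univ i)]
  refine mul_neg_of_neg_of_pos ?_ (prod_pos fun l hl => ?_)
  · simp only [Fin.succAbove_castSucc_self, Fin.succAbove_succ_self]
    have : x i.castSucc < x i.succ := hx (Fin.castSucc_lt_succ)
    nlinarith
  · have hl := (mem_erase.1 hl).1
    rcases lt_or_gt_of_ne hl with h | h
    · rw [Fin.succAbove_of_castSucc_lt _ _ (by simp only [Fin.lt_def, Fin.le_def, Fin.val_castSucc, Fin.val_succ] at h ⊢; omega), 
        Fin.succAbove_of_castSucc_lt _ _ (by simp only [Fin.lt_def, Fin.le_def, Fin.val_castSucc, Fin.val_succ] at h ⊢; omega)]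
      have h1 : x l.castSucc < x i.castSucc := hx (by simp only [Fin.lt_def, Fin.le_def, Fin.val_castSucc, Fin.val_succ] at h ⊢; omega)
      have h2 : x l.castSucc < x i.succ := hx (by simp only [Fin.lt_def, Fin.le_def, Fin.val_castSucc, Fin.val_succ] at h ⊢; omega)
      exact mul_pos (by linarith) (by linarith)
    · rw [Fin.succAbove_of_le_castSucc _ _ (by simp only [Fin.lt_def, Fin.le_def, Fin.val_castSucc, Fin.val_succ] at h ⊢; omega), 
        Fin.succAbove_of_le_castSucc _ _ (by simp only [Fin.lt_def, Fin.le_def, Fin.val_castSucc, Fin.val_succ] at h ⊢; omega)]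
      have h1 : x i.castSucc < x l.succ := hx (by simp only [Fin.lt_def, Fin.le_def, Fin.val_castSucc, Fin.val_succ] at h ⊢; omega)
      have h2 : x i.succ < x l.succ := hx (by simp only [Fin.lt_def, Fin.le_def, Fin.val_castSucc, Fin.val_succ] at h ⊢; omega)
      exact mul_pos_of_neg_of_neg (by linarith) (by linarith)

theorem Phi_surj {k : ℕ} {x : Fin (k+1) → ℝ} (hx : StrictMono x) (w : Fin (k+1) → ℝ) (hw : ∀ j, 0 < w j)
    (hs : ∑ j, w j = 1) : ∃ y ∈ Wo x, Phi x y = w := by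
  have hroot : ∀ i : Fin k, ∃ a, (x i.castSucc < a ∧ a < x i.succ) ∧ (Rpol x w).eval a = 0 := by
    intro i
    have hlt : x i.castSucc < x i.succ := hx (Fin.castSucc_lt_succ)
    have hc : ContinuousOn (fun a => (Rpol x w).eval a) (Set.Icc (x i.castSucc) (x i.succ)) :=
      (Rpol x w).continuous.continuousOn
    have hd := Den_sign hx i
    have hprod : (Rpol x w).eval (x i.castSucc) * (Rpol x w).eval (x i.succ) < 0 := by
      rw [Rpol_eval_x, Rpol_eval_x]
      have := mul_pos (hw i.castSucc) (hw i.succ)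
      nlinarith
    rcases mul_neg_iff.1 hprod with ⟨h1, h2⟩ | ⟨h1, h2⟩
    · obtain ⟨a, ha, h⟩ := intermediate_value_Ioo' hlt.le hc ⟨h2, h1⟩
      exact ⟨a, ha, h⟩
    · obtain ⟨a, ha, h⟩ := intermediate_value_Ioo hlt.le hc ⟨h1, h2⟩
      exact ⟨a, ha, h⟩
  choose y hy hy0 using hroot
  have hyW : y ∈ Wo x := hy
  refine ⟨y, hyW, ?_⟩
  have hdeg : (Rpol x w - Ypol y).degree < (k : ℕ) := by
    rw [Polynomial.degree_lt_iff_coeff_zero]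
    intro m hm
    rcases hm.eq_or_lt with h | h
    · rw [← h, Polynomial.coeff_sub, Rpol_coeff, hs, Ypol_coeff, sub_self]
    · rw [Polynomial.coeff_sub, Polynomial.coeff_eq_zero_of_degree_lt, 
        Polynomial.coeff_eq_zero_of_degree_lt, sub_self]
      · rw [Ypol_degree]; exact_mod_cast h
      · exact lt_of_lt_of_le (Rpol_degree x w) (by exact_mod_cast h)
  have heq : Rpol x w = Ypol y := by
    refine Polynomial.eq_of_degree_sub_lt_of_eval_index_eq univ (v := y) 
      (Wo_strictMono hx hyW).injective.injOn (by simpa using hdeg) ?_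
    intro i _
    rw [hy0, Ypol_eval, prod_eq_zero (mem_univ i) (by simp)]
  funext j
  have h := congrArg (Polynomial.eval (x j)) heq
  rw [Rpol_eval_x, Ypol_eval] at h
  rw [Phi, ← h, mul_div_cancel_right₀ _ (Den_ne hx.injective j)]


noncomputable def Vd {k : ℕ} (x : Fin k → ℝ) : ℝ := ∏ i, ∏ j ∈ Ioi i, (x j - x i)

theorem Vd_pos {k : ℕ} {x : Fin k → ℝ} (hx : StrictMono x) : 0 < Vd x :=
  prod_pos fun _ _ => prod_pos fun _ hj => sub_pos.2 (hx (mem_Ioi.1 hj))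

theorem off_diag_abs {k : ℕ} (y : Fin k → ℝ) :
    ∏ i, ∏ m ∈ univ.erase i, |y i - y m| = |Vd y| ^ 2 := by
  have h := Finset.prod_prod_Ioi_mul_eq_prod_prod_off_diag (fun i j : Fin k => |y j - y i|)
  have e : ∀ i : Fin k, univ.erase i = {i}ᶜ := fun i => by ext; simp
  simp only [e]
  rw [← h, Vd, abs_prod, sq, ← prod_mul_distrib]
  refine prod_congr rfl fun i _ => ?_
  rw [abs_prod, ← prod_mul_distrib]
  refine prod_congr rfl fun j _ => ?_
  rw [abs_sub_comm (y i) (y j)]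

theorem abs_det_N {k : ℕ} (a y : Fin k → ℝ) (hy : Function.Injective y) :
    |(Matrix.of fun j i => ∏ m ∈ univ.erase i, (a j - y m)).det| = |Vd a| * |Vd y| := by
  set C : Matrix (Fin k) (Fin k) ℝ := Matrix.of fun n i => 
    (∏ m ∈ univ.erase i, (Polynomial.X - Polynomial.C (y m))).coeff n with hC
  have hN : ∀ a : Fin k → ℝ, (Matrix.of fun j i => ∏ m ∈ univ.erase i, (a j - y m)) = 
      Matrix.vandermonde a * C := by
    intro a
    ext j i
    rw [Matrix.mul_apply]
    simp only [Matrix.of_apply, Matrix.vandermonde_apply, hC]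
    have hd : (∏ m ∈ univ.erase i, (Polynomial.X - Polynomial.C (y m))).natDegree < k := by
      rw [Polynomial.natDegree_finsetProd_X_sub_C_eq_card]; simp
      have := i.2; omega
    have := Polynomial.eval_eq_sum_range' hd (a j)
    rw [Finset.sum_range] at this
    rw [Polynomial.eval_prod] at this
    simp only [Polynomial.eval_sub, Polynomial.eval_X, Polynomial.eval_C] at this
    rw [this]
    exact sum_congr rfl fun _ _ => mul_comm _ _
  have hV : Vd y ≠ 0 := by
    have := Matrix.det_vandermonde_ne_zero_iff.2 hy
    rwa [Matrix.det_vandermonde] at this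
  have hy2 : |(Matrix.of fun j i => ∏ m ∈ univ.erase i, (y j - y m)).det| = |Vd y| ^ 2 := by
    have : (Matrix.of fun j i => ∏ m ∈ univ.erase i, (y j - y m)) = 
        Matrix.diagonal fun i => ∏ m ∈ univ.erase i, (y i - y m) := by
      ext j i
      simp only [Matrix.of_apply, Matrix.diagonal_apply]
      split_ifs with h
      · rw [h]
      · exact prod_eq_zero (i := j) (by simp [h]) (by simp)
    rw [this, Matrix.det_diagonal, abs_prod, ← off_diag_abs]
    simp only [abs_prod]
  rw [hN, Matrix.det_mul, abs_mul, Matrix.det_vandermonde] at hy2 ⊢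
  change |Vd a| * _ = _
  change |Vd y| * _ = _ at hy2
  rw [sq] at hy2
  rw [mul_left_cancel₀ (abs_ne_zero.2 hV) hy2]

noncomputable def JM {k : ℕ} (x : Fin (k+1) → ℝ) (y : Fin k → ℝ) : Matrix (Fin k) (Fin k) ℝ :=
  Matrix.of fun j i => (-(Den x j.succ)⁻¹) * ∏ m ∈ univ.erase i, (x j.succ - y m)

theorem abs_Den_prod {k : ℕ} (x : Fin (k+1) → ℝ) : ∏ j, |Den x j| = |Vd x| ^ 2 := by
  rw [← off_diag_abs]
  refine prod_congr rfl fun j _ => ?_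
  rw [prod_erase_succAbove j (fun m => |x j - x m|), Den, abs_prod]

theorem Vd_succ {k : ℕ} (x : Fin (k+1) → ℝ) : |Vd x| = |Den x 0| * |Vd (fun j => x j.succ)| := by
  unfold Vd
  rw [Fin.prod_univ_succ, abs_mul]
  congr 1
  · rw [Fin.prod_Ioi_zero, Den, abs_prod, abs_prod]
    refine prod_congr rfl fun i _ => ?_
    rw [abs_sub_comm]; simp
  · congr 1
    refine prod_congr rfl fun i _ => ?_
    rw [Fin.prod_Ioi_succ]

theorem abs_det_JM {k : ℕ} {x : Fin (k+1) → ℝ} {y : Fin k → ℝ} (hx : StrictMono x)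
    (hy : Function.Injective y) : |(JM x y).det| = |Vd y| / |Vd x| := by
  unfold JM
  have h := Matrix.det_mul_column (fun j : Fin k => -(Den x j.succ)⁻¹) 
    (Matrix.of fun j i => ∏ m ∈ univ.erase i, (x j.succ - y m))
  have e : (Matrix.of fun j i => -(Den x j.succ)⁻¹ * ∏ m ∈ univ.erase i, (x j.succ - y m)) = 
    (Matrix.of fun i j => (fun j : Fin k => -(Den x j.succ)⁻¹) i * 
      (Matrix.of fun j i => ∏ m ∈ univ.erase i, (x j.succ - y m)) i j) := rfl
  rw [e, h, abs_mul, abs_det_N _ _ hy, abs_prod]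
  simp only [abs_neg, abs_inv, prod_inv_distrib]
  have h1 := abs_Den_prod x
  rw [Fin.prod_univ_succ] at h1
  have h2 := Vd_succ x
  have h3 : 0 < |Den x 0| := abs_pos.2 (Den_ne hx.injective 0)
  have h4 : 0 < |Vd x| := abs_pos.2 (Vd_pos hx).ne'
  have h5 : 0 < |Vd fun j : Fin k => x j.succ| := by
    refine abs_pos.2 (Vd_pos ?_).ne'
    exact fun i j h => hx (Fin.succ_lt_succ_iff.2 h)
  have h6 : ∏ j : Fin k, |Den x j.succ| = |Vd x| * |Vd fun j : Fin k => x j.succ| := by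
    apply mul_left_cancel₀ h3.ne'
    rw [h1, sq]
    nth_rewrite 2 [h2]
    ring
  rw [h6]
  field_simp

noncomputable def Gm {k : ℕ} (x : Fin (k+1) → ℝ) (y : Fin k → ℝ) (j : Fin k) : ℝ := Phi x y j.succ

theorem Gm_deriv {k : ℕ} (x : Fin (k+1) → ℝ) (y : Fin k → ℝ) :
    HasFDerivAt (Gm x) (LinearMap.toContinuousLinearMap (Matrix.toLin' (JM x y))) y := by
  rw [hasFDerivAt_pi']
  intro j
  have h : ∀ i : Fin k, HasFDerivAt (fun y : Fin k → ℝ => x j.succ - y i) 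
      (-(ContinuousLinearMap.proj i : (Fin k → ℝ) →L[ℝ] ℝ)) y := fun i => 
    ((ContinuousLinearMap.proj i : (Fin k → ℝ) →L[ℝ] ℝ).hasFDerivAt).const_sub _
  have h2 := (HasFDerivAt.finsetProd (u := univ) (fun i _ => h i)).mul_const ((Den x j.succ)⁻¹)
  have e : (fun y : Fin k → ℝ => Gm x y j) = fun y => (∏ i, (x j.succ - y i)) * (Den x j.succ)⁻¹ := by
    funext y; rw [Gm, Phi, div_eq_mul_inv]
  rw [e]
  refine h2.congr_fderiv ?_
  ext v
  simp [JM, Matrix.toLin'_apply, Matrix.mulVec, dotProduct, mul_sum, mul_assoc]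

theorem det_Gm {k : ℕ} (x : Fin (k+1) → ℝ) (y : Fin k → ℝ) : 
    (LinearMap.toContinuousLinearMap (Matrix.toLin' (JM x y))).det = (JM x y).det := by
  rw [LinearMap.det_toContinuousLinearMap, LinearMap.det_toLin']


def TT (k : ℕ) : Set (Fin k → ℝ) := {w | (∀ i, 0 < w i) ∧ ∑ i, w i < 1}

noncomputable def wb {k : ℕ} (w : Fin k → ℝ) : Fin (k+1) → ℝ := Fin.cons (1 - ∑ i, w i) w

noncomputable def rho {k : ℕ} (θ : ℝ) (w : Fin k → ℝ) : ℝ := ∏ j, (wb w j) ^ (θ - 1)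

theorem wb_Gm {k : ℕ} {x : Fin (k+1) → ℝ} (hx : Function.Injective x) (y : Fin k → ℝ) :
    wb (Gm x y) = Phi x y := by
  funext j
  refine Fin.cases ?_ (fun i => ?_) j
  · have := Phi_sum hx y
    rw [Fin.sum_univ_succ] at this
    simp only [wb, Fin.cons_zero, Gm]
    linarith
  · simp [wb, Gm]

theorem wb_pos {k : ℕ} {w : Fin k → ℝ} (hw : w ∈ TT k) (j) : 0 < wb w j := by
  refine Fin.cases ?_ (fun i => ?_) j
  · simp [wb, hw.2]
  · simp [wb, hw.1 i]

theorem wb_sum {k : ℕ} (w : Fin k → ℝ) : ∑ j, wb w j = 1 := by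
  rw [Fin.sum_univ_succ]; simp [wb]

theorem Gm_image {k : ℕ} {x : Fin (k+1) → ℝ} (hx : StrictMono x) : Gm x '' Wo x = TT k := by
  ext w
  constructor
  · rintro ⟨y, hy, rfl⟩
    refine ⟨fun i => Phi_pos hx hy _, ?_⟩
    have := Phi_sum hx.injective y
    rw [Fin.sum_univ_succ] at this
    have h0 := Phi_pos hx hy 0
    simp only [Gm]; linarith
  · intro hw
    obtain ⟨y, hy, h⟩ := Phi_surj hx (wb w) (wb_pos hw) (wb_sum w)
    refine ⟨y, hy, ?_⟩
    funext j
    rw [Gm, h]; simp [wb]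

theorem Gm_injOn {k : ℕ} {x : Fin (k+1) → ℝ} (hx : StrictMono x) : Set.InjOn (Gm x) (Wo x) := by
  intro y hy y' hy' h
  refine Phi_inj hx hy hy' ?_
  rw [← wb_Gm hx.injective, ← wb_Gm hx.injective, h]

theorem Wo_eq {k : ℕ} (x : Fin (k+1) → ℝ) : Wo x = Set.univ.pi fun i : Fin k => Set.Ioo (x i.castSucc) (x i.succ) := by
  ext y; simp [Wo]

theorem Wo_open {k : ℕ} (x : Fin (k+1) → ℝ) : IsOpen (Wo x) := by
  rw [Wo_eq]; exact isOpen_set_pi Set.finite_univ fun _ _ => isOpen_Ioo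

theorem DAdomain_eq {k : ℕ} (x : Fin (k+1) → ℝ) : 
    DAdomain k x = Set.univ.pi fun i : Fin k => Set.Icc (x i.castSucc) (x i.succ) := by
  ext y; simp only [DAdomain, Set.mem_ofPred_eq, Set.mem_univ_pi, Set.mem_Icc]

theorem Wo_ae {k : ℕ} (x : Fin (k+1) → ℝ) : Wo x =ᵐ[volume] DAdomain k x := by
  rw [Wo_eq, DAdomain_eq, Set.pi_univ_Icc]
  exact Measure.univ_pi_Ioo_ae_eq_Icc

noncomputable def kap (k : ℕ) (β : ℝ) : ℝ := Real.Gamma (β * (k + 1) / 2) / Real.Gamma (β / 2) ^ (k + 1)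

theorem Phi_prod {k : ℕ} {x : Fin (k+1) → ℝ} (hx : StrictMono x) {y : Fin k → ℝ} (hy : y ∈ Wo x) (s : ℝ) :
    ∏ j, Phi x y j ^ s = (∏ i, ∏ j, |y i - x j| ^ s) * (Vd x ^ 2) ^ (-s) := by
  have h1 : ∏ j, Phi x y j = (∏ i, ∏ j, |y i - x j|) * (Vd x ^ 2)⁻¹ := by
    have : ∀ j, Phi x y j = |Phi x y j| := fun j => (abs_of_pos (Phi_pos hx hy j)).symm
    rw [prod_congr rfl fun j _ => this j]
    simp only [Phi, abs_div]
    rw [prod_div_distrib, abs_Den_prod, div_eq_mul_inv, sq_abs, prod_comm]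
    congr 1
    refine prod_congr rfl fun j _ => ?_
    rw [abs_prod]
    exact prod_congr rfl fun i _ => abs_sub_comm _ _
  have hV := Vd_pos hx
  rw [Real.finsetProd_rpow _ _ (fun j _ => (Phi_pos hx hy j).le), h1, Real.mul_rpow 
    (prod_nonneg fun i _ => prod_nonneg fun j _ => abs_nonneg _) (by positivity),
    Real.inv_rpow (by positivity), Real.rpow_neg (by positivity)]
  congr 1
  rw [← Real.finsetProd_rpow _ _ (fun i _ => prod_nonneg fun j _ => abs_nonneg _)]
  refine prod_congr rfl fun i _ => ?_
  rw [← Real.finsetProd_rpow _ _ (fun i _ => abs_nonneg _)]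

theorem jac_rho {k : ℕ} (θ : ℝ) {x : Fin (k+1) → ℝ} (hx : StrictMono x) {y : Fin k → ℝ} (hy : y ∈ Wo x) :
    |(JM x y).det| * rho θ (Gm x y) = Vd x ^ (1 - 2 * θ) * (Vd y * ∏ i, ∏ j, |y i - x j| ^ (θ - 1)) := by
  have hV := Vd_pos hx
  have hy2 := Wo_strictMono hx hy
  rw [abs_det_JM hx hy2.injective, rho, wb_Gm hx.injective, Phi_prod hx hy, abs_of_pos hV, abs_of_pos (Vd_pos hy2)]
  have : (Vd x ^ 2) ^ (-(θ-1)) = Vd x ^ (1 - 2 * θ) * Vd x := by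
    rw [← Real.rpow_natCast, ← Real.rpow_mul hV.le]
    nth_rewrite 3 [← Real.rpow_one (Vd x)]
    rw [← Real.rpow_add hV]
    congr 1; push_cast; ring
  rw [this]; field_simp

theorem DAdensity_eq {k : ℕ} (β : ℝ) {x : Fin (k+1) → ℝ} (hx : StrictMono x) {y : Fin k → ℝ} (hy : y ∈ Wo x) :
    DAdensity k β x y = kap k β * (|(JM x y).det| * rho (β/2) (Gm x y)) := by
  rw [jac_rho _ hx hy, DAdensity, kap]
  have : ∏ i : Fin (k + 1), ∏ j ∈ Ioi i, (x j - x i) ^ (1 - β) = Vd x ^ (1 - 2 * (β/2)) := by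
    rw [Vd, ← Real.finsetProd_rpow _ _ (fun i _ => prod_nonneg fun j hj => 
      sub_nonneg.2 (hx (mem_Ioi.1 hj)).le)]
    refine prod_congr rfl fun i _ => ?_
    rw [← Real.finsetProd_rpow _ _ (fun j hj => sub_nonneg.2 (hx (mem_Ioi.1 hj)).le)]
    refine prod_congr rfl fun j _ => ?_
    congr 1; ring
  rw [this, Vd]
  simp only [Vd]
  ring

theorem cov {k : ℕ} (β : ℝ) {x : Fin (k+1) → ℝ} (hx : StrictMono x) (f : (Fin k → ℝ) → ℝ) (g : (Fin (k+1) → ℝ) → ℝ)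
    (hfg : ∀ y ∈ Wo x, f y = g (Phi x y)) :
    ∫ y in DAdomain k x, DAdensity k β x y * f y = 
      kap k β * ∫ w in TT k, rho (β/2) w * g (wb w) := by
  rw [← setIntegral_congr_set (Wo_ae x), ← Gm_image hx,
    integral_image_eq_integral_abs_det_fderiv_smul volume (Wo_open x).measurableSet
      (fun y _ => (Gm_deriv x y).hasFDerivWithinAt) (Gm_injOn hx), ← integral_const_mul]
  refine setIntegral_congr_fun (Wo_open x).measurableSet fun y hy => ?_
  rw [DAdensity_eq β hx hy, det_Gm, wb_Gm hx.injective, hfg y hy, smul_eq_mul]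
  ring

theorem int1d (s r : ℝ) (hs : -1 < s) (hr : -1 < r) {a b : ℝ} (hab : a < b) : 
    IntegrableOn (fun y : ℝ => |y - a| ^ s * |y - b| ^ r) (Set.Icc a b) := by
  have base1 : ∀ c e : ℝ, c < e → IntegrableOn (fun y : ℝ => |y - c| ^ s) (Set.Icc c e) := by
    intro c e hce
    have h0 := (intervalIntegral.intervalIntegrable_rpow' (a := 0) (b := e - c) hs).comp_sub_right c
    simp only [zero_add, sub_add_cancel] at h0
    rw [intervalIntegrable_iff_integrableOn_Icc_of_le hce.le] at h0
    refine h0.congr_fun (fun y hy => ?_) measurableSet_Icc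
    simp only
    rw [abs_of_nonneg (sub_nonneg.2 hy.1)]
  have base2 : ∀ c e : ℝ, c < e → IntegrableOn (fun y : ℝ => |y - e| ^ r) (Set.Icc c e) := by
    intro c e hce
    have h0 := (intervalIntegral.intervalIntegrable_rpow' (a := e - c) (b := 0) hr).comp_sub_left e
    simp only [sub_zero, sub_sub_cancel] at h0
    rw [intervalIntegrable_iff_integrableOn_Icc_of_le hce.le] at h0
    refine h0.congr_fun (fun y hy => ?_) measurableSet_Icc
    simp only
    rw [abs_sub_comm, abs_of_nonneg (sub_nonneg.2 hy.2)]
  have hm : a < (a+b)/2 := by linarith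
  have hm2 : (a+b)/2 < b := by linarith
  rw [← Set.Icc_union_Icc_eq_Icc hm.le hm2.le]
  refine IntegrableOn.union ?_ ?_
  · refine IntegrableOn.mul_continuousOn (base1 _ _ hm) ?_ isCompact_Icc
    refine ContinuousOn.rpow_const (by fun_prop) fun y hy => Or.inl ?_
    exact abs_ne_zero.2 (by have := hy.2; intro h; linarith)
  · refine IntegrableOn.continuousOn_mul ?_ (base2 _ _ hm2) isCompact_Icc
    refine ContinuousOn.rpow_const (by fun_prop) fun y hy => Or.inl ?_
    exact abs_ne_zero.2 (by have := hy.1; intro h; linarith)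

theorem rho_integrable (k : ℕ) (θ : ℝ) (hθ : 0 < θ) : IntegrableOn (rho θ) (TT k) := by
  set x : Fin (k+1) → ℝ := fun j => (j : ℝ) with hxdef
  have hx : StrictMono x := fun i j h => by simpa [hxdef] using h
  rw [← Gm_image hx, integrableOn_image_iff_integrableOn_abs_det_fderiv_smul volume (Wo_open x).measurableSet
      (fun y _ => (Gm_deriv x y).hasFDerivWithinAt) (Gm_injOn hx)]
  have : IntegrableOn (fun y => Vd x ^ (1 - 2 * θ) * (Vd y * ∏ i, ∏ j, |y i - x j| ^ (θ - 1))) (DAdomain k x) := by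
    refine Integrable.const_mul ?_ _
    have e : ∀ y : Fin k → ℝ, Vd y * ∏ i, ∏ j, |y i - x j| ^ (θ - 1) = 
        (Vd y * ∏ i, ∏ j ∈ (univ.erase i.castSucc).erase i.succ, |y i - x j| ^ (θ - 1)) * 
        ∏ i : Fin k, (|y i - x i.castSucc| ^ (θ-1) * |y i - x i.succ| ^ (θ-1)) := by
      intro y
      rw [mul_assoc, ← prod_mul_distrib]
      congr 1
      refine prod_congr rfl fun i _ => ?_
      rw [← mul_prod_erase univ _ (mem_univ i.castSucc), 
        ← mul_prod_erase (univ.erase i.castSucc) _ (mem_erase.2 ⟨(Fin.castSucc_lt_succ).ne', mem_univ i.succ⟩)]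
      ring
    simp_rw [e]
    have hK : IsCompact (DAdomain k x) := by
      rw [DAdomain_eq]; exact isCompact_univ_pi fun _ => isCompact_Icc
    refine IntegrableOn.continuousOn_mul ?_ ?_ hK
    · refine ContinuousOn.mul (by unfold Vd; fun_prop) ?_
      refine continuousOn_finsetProd _ fun i _ => continuousOn_finsetProd _ fun j hj => ?_
      refine ContinuousOn.rpow_const (by fun_prop) fun y hy => Or.inl ?_
      have h1 := (mem_erase.1 hj).1
      have h2 := (mem_erase.1 (mem_erase.1 hj).2).1
      have hyi := hy i
      refine abs_ne_zero.2 (sub_ne_zero.2 ?_)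
      rcases lt_or_ge j i.castSucc with h | h
      · exact ((hx h).trans_le hyi.1).ne'
      · have : i.succ < j := by
          refine lt_of_le_of_ne ?_ h1.symm
          have := lt_of_le_of_ne h h2.symm
          simp only [Fin.lt_def, Fin.le_def, Fin.val_castSucc, Fin.val_succ] at this ⊢; omega
        exact (hyi.2.trans_lt (hx this)).ne
    · rw [DAdomain_eq, IntegrableOn, volume_pi, Measure.restrict_pi_pi]
      refine Integrable.fintype_prod (f := fun (i : Fin k) (y : ℝ) => 
        |y - x i.castSucc| ^ (θ-1) * |y - x i.succ| ^ (θ-1)) fun i => ?_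
      exact int1d _ _ (by linarith) (by linarith) (hx Fin.castSucc_lt_succ)
  refine ((integrableOn_congr_set_ae (Wo_ae x)).2 this).congr_fun (fun y hy => ?_) (Wo_open x).measurableSet
  simp only
  rw [← jac_rho θ hx hy, det_Gm, smul_eq_mul]


theorem wb_continuous (k : ℕ) (j : Fin (k+1)) : Continuous fun w : Fin k → ℝ => wb w j := by
  refine Fin.cases ?_ (fun i => ?_) j
  · simp only [wb, Fin.cons_zero]; fun_prop
  · simp only [wb, Fin.cons_succ]; fun_prop

theorem TT_open (k : ℕ) : IsOpen (TT k) := by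
  have : TT k = (⋂ i, {w : Fin k → ℝ | 0 < w i}) ∩ {w | ∑ i, w i < 1} := by
    ext w; simp [TT]
  rw [this]
  refine IsOpen.inter (isOpen_iInter_of_finite fun i => ?_) ?_
  · exact isOpen_lt continuous_const (continuous_apply i)
  · exact isOpen_lt (by fun_prop) continuous_const

theorem TT_sub (k : ℕ) : TT k ⊆ Set.Icc 0 1 := by
  intro w hw
  refine ⟨fun i => (hw.1 i).le, fun i => ?_⟩
  have : w i ≤ ∑ i, w i := single_le_sum (fun j _ => (hw.1 j).le) (mem_univ i)
  exact this.trans hw.2.le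

theorem rho_mul_integrable (k : ℕ) (θ : ℝ) (hθ : 0 < θ) (g : (Fin k → ℝ) → ℝ) (hg : Continuous g) :
    IntegrableOn (fun w => rho θ w * g w) (TT k) := by
  obtain ⟨C, hC⟩ := (isCompact_Icc (a := (0 : Fin k → ℝ)) (b := 1)).exists_bound_of_continuousOn hg.continuousOn
  refine Integrable.mul_bdd (c := C) (rho_integrable k θ hθ) hg.aestronglyMeasurable ?_
  rw [ae_restrict_iff' (TT_open k).measurableSet]
  exact Filter.Eventually.of_forall fun w hw => hC w (TT_sub k hw)

theorem int_slice (p q c : ℝ) (hp : 0 < p) (hq : 0 < q) (hc : 0 < c) :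
    ∫ a in Set.Ioo 0 c, (p * (c - a) - q * a) * ((c - a) ^ (q - 1) * a ^ (p - 1)) = 0 := by
  rw [← integral_Ioc_eq_integral_Ioo, ← intervalIntegral.integral_of_le hc.le]
  have hcont : ContinuousOn (fun a : ℝ => a ^ p * (c - a) ^ q) (Set.Icc 0 c) := by
    refine ContinuousOn.mul ?_ ?_
    · exact ContinuousOn.rpow_const (by fun_prop) fun _ _ => Or.inr hp.le
    · exact ContinuousOn.rpow_const (by fun_prop) fun _ _ => Or.inr hq.le
  have hint : IntervalIntegrable (fun a => (p * (c - a) - q * a) * ((c - a) ^ (q - 1) * a ^ (p - 1))) volume 0 c := by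
    rw [intervalIntegrable_iff_integrableOn_Icc_of_le hc.le]
    refine IntegrableOn.continuousOn_mul (by fun_prop) ?_ isCompact_Icc
    refine (int1d (p-1) (q-1) (by linarith) (by linarith) hc).congr_fun (fun a ha => ?_) measurableSet_Icc
    simp only
    rw [sub_zero, abs_of_nonneg ha.1, abs_sub_comm, abs_of_nonneg (sub_nonneg.2 ha.2), mul_comm]
  rw [intervalIntegral.integral_eq_sub_of_hasDerivAt_of_le hc.le hcont ?_ hint]
  · simp [hp.ne', hq.ne']
  · intro a ha
    have h1 := Real.hasDerivAt_rpow_const (x := a) (p := p) (Or.inl ha.1.ne')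
    have h2 := ((hasDerivAt_id a).const_sub c).rpow_const (p := q) (Or.inl (sub_pos.2 ha.2).ne')
    refine (h1.mul h2).congr_deriv ?_
    have e1 : a ^ p = a ^ (p - 1) * a := by
      rw [← Real.rpow_add_one ha.1.ne']; ring_nf
    have e2 : (c - a) ^ q = (c - a) ^ (q - 1) * (c - a) := by
      rw [← Real.rpow_add_one (sub_pos.2 ha.2).ne']; ring_nf
    simp only [id] at *
    rw [e1, e2]; ring

theorem dir_ibp0 (n : ℕ) (θ : ℝ) (hθ : 0 < θ) (α : Fin (n+2) → ℕ) (m : Fin (n+1)) :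
    ∫ w in TT (n+1), rho θ w * (((θ + α m.succ) * wb w 0 - (θ + α 0) * wb w m.succ) * ∏ j, wb w j ^ α j) = 0 := by
  set f : (Fin (n+1) → ℝ) → ℝ := fun w => 
    rho θ w * (((θ + α m.succ) * wb w 0 - (θ + α 0) * wb w m.succ) * ∏ j, wb w j ^ α j) with hf
  have hint : IntegrableOn f (TT (n+1)) := by
    refine rho_mul_integrable _ θ hθ _ ?_
    have := wb_continuous (n+1)
    fun_prop
  rw [← integral_indicator (TT_open _).measurableSet]
  rw [← integrable_indicator_iff (TT_open _).measurableSet] at hint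
  have mp := (volume_preserving_piFinSuccAbove (fun _ : Fin (n+1) => ℝ) m).symm
  rw [← mp.integral_comp (MeasurableEquiv.measurableEmbedding _)]
  rw [← mp.integrable_comp_emb (MeasurableEquiv.measurableEmbedding _)] at hint
  change ∫ z : ℝ × (Fin n → ℝ), _ ∂(volume.prod volume) = 0
  refine (integral_prod_symm _ hint).trans ?_
  refine integral_eq_zero_of_ae (Filter.Eventually.of_forall fun w' => ?_)
  simp only [Pi.zero_apply]
  change ∫ a, (TT (n+1)).indicator f (m.insertNth a w') = 0
  by_cases hw : (∀ l, 0 < w' l) ∧ 0 < 1 - ∑ l, w' l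
  · obtain ⟨hw0, hc⟩ := hw
    set c := 1 - ∑ l, w' l with hcd
    have hsum : ∀ a, ∑ i, (m.insertNth a w' : Fin (n+1) → ℝ) i = a + ∑ l, w' l := by
      intro a; rw [Fin.sum_univ_succAbove _ m]; simp
    have hmem : ∀ a, (m.insertNth a w' : Fin (n+1) → ℝ) ∈ TT (n+1) ↔ a ∈ Set.Ioo 0 c := by
      intro a
      simp only [TT, Set.mem_ofPred_eq, hsum, Set.mem_Ioo, Fin.forall_iff_succAbove m, Fin.insertNth_apply_same,
        Fin.insertNth_apply_succAbove]
      constructor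
      · rintro ⟨⟨h1, _⟩, h2⟩; exact ⟨h1, by linarith⟩
      · rintro ⟨h1, h2⟩; exact ⟨⟨h1, hw0⟩, by linarith⟩
    have e : ∀ a, (TT (n+1)).indicator f (m.insertNth a w') = (Set.Ioo 0 c).indicator 
        (fun a => f (m.insertNth a w')) a := by
      intro a
      simp only [Set.indicator, hmem]
    simp only [e]
    rw [integral_indicator measurableSet_Ioo]
    have hfa : ∀ a ∈ Set.Ioo 0 c, f (m.insertNth a w') = 
        (∏ l : Fin n, (w' l) ^ (θ + α (m.succAbove l).succ - 1)) * 
        (((θ + α m.succ) * (c - a) - (θ + α 0) * a) * ((c - a) ^ ((θ + α 0) - 1) * a ^ ((θ + α m.succ) - 1))) := by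
      intro a ha
      have h0 : wb (m.insertNth a w' : Fin (n+1) → ℝ) 0 = c - a := by
        simp only [wb, Fin.cons_zero, hsum]; rw [hcd]; ring
      have hm : wb (m.insertNth a w' : Fin (n+1) → ℝ) m.succ = a := by
        simp [wb]
      have hl : ∀ l, wb (m.insertNth a w' : Fin (n+1) → ℝ) (m.succAbove l).succ = w' l := by
        intro l; simp [wb]
      have hcomb : rho θ (m.insertNth a w' : Fin (n+1) → ℝ) * ∏ j, wb (m.insertNth a w' : Fin (n+1) → ℝ) j ^ α j = 
          ∏ j, wb (m.insertNth a w' : Fin (n+1) → ℝ) j ^ (θ + α j - 1) := by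
        rw [rho, ← prod_mul_distrib]
        refine prod_congr rfl fun j _ => ?_
        rw [← Real.rpow_natCast, ← Real.rpow_add (wb_pos ((hmem a).2 ha) j)]
        congr 1; ring
      rw [hf]
      simp only
      rw [mul_left_comm, hcomb, Fin.prod_univ_succ, Fin.prod_univ_succAbove _ m, h0, hm]
      simp only [hl]
      ring
    rw [setIntegral_congr_fun measurableSet_Ioo hfa, integral_const_mul, int_slice _ _ _ 
      (by positivity) (by positivity) hc, mul_zero]
  · have e : ∀ a, (TT (n+1)).indicator f (m.insertNth a w') = 0 := by
      intro a
      refine Set.indicator_of_notMem (fun h => hw ?_) _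
      have h1 := h.1
      have h2 := h.2
      rw [Fin.sum_univ_succAbove _ m] at h2
      rw [Fin.forall_iff_succAbove m] at h1
      simp only [Fin.insertNth_apply_same, Fin.insertNth_apply_succAbove] at h1 h2
      exact ⟨h1.2, by linarith [h1.1]⟩
    simp [e]


noncomputable def Mom {k : ℕ} (θ : ℝ) (α : Fin (k+1) → ℕ) : ℝ :=
  ∫ w in TT k, rho θ w * ∏ j, wb w j ^ α j

theorem mom_int {k : ℕ} (θ : ℝ) (hθ : 0 < θ) (α : Fin (k+1) → ℕ) :
    IntegrableOn (fun w : Fin k → ℝ => rho θ w * ∏ j, wb w j ^ α j) (TT k) := by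
  refine rho_mul_integrable _ θ hθ _ ?_
  have := wb_continuous k
  fun_prop

theorem prod_pow_single {k : ℕ} (w : Fin k → ℝ) (α : Fin k → ℕ) (m : Fin k) :
    ∏ j, w j ^ (α + Pi.single m 1 : Fin k → ℕ) j = w m * ∏ j, w j ^ α j := by
  simp only [Pi.add_apply, pow_add, prod_mul_distrib]
  rw [mul_comm]
  congr 1
  rw [prod_eq_single m]
  · simp
  · intro b _ hb; simp [Pi.single_apply, hb]
  · simp

theorem mom_rel0 {k : ℕ} (θ : ℝ) (hθ : 0 < θ) (α : Fin (k+1) → ℕ) (m : Fin (k+1)) :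
    (θ + α m) * Mom θ (α + Pi.single 0 1) = (θ + α 0) * Mom θ (α + Pi.single m 1) := by
  refine Fin.cases rfl (fun i => ?_) m
  obtain ⟨n, rfl⟩ : ∃ n, k = n + 1 := ⟨k - 1, by have := i.2; omega⟩
  have h := dir_ibp0 n θ hθ α i
  have e : ∀ w : Fin (n+1) → ℝ, rho θ w * (((θ + α i.succ) * wb w 0 - (θ + α 0) * wb w i.succ) * ∏ j, wb w j ^ α j) =
    (θ + α i.succ) * (rho θ w * ∏ j, wb w j ^ (α + Pi.single 0 1 : Fin (n+1+1) → ℕ) j) - 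
    (θ + α 0) * (rho θ w * ∏ j, wb w j ^ (α + Pi.single i.succ 1 : Fin (n+1+1) → ℕ) j) := by
    intro w
    rw [prod_pow_single, prod_pow_single]; ring
  simp only [e] at h
  rw [integral_sub ((mom_int θ hθ _).const_mul _) ((mom_int θ hθ _).const_mul _), integral_const_mul,
    integral_const_mul] at h
  exact sub_eq_zero.1 h

theorem mom_rel {k : ℕ} (θ : ℝ) (hθ : 0 < θ) (α : Fin (k+1) → ℕ) (m m' : Fin (k+1)) :
    (θ + α m) * Mom θ (α + Pi.single m' 1) = (θ + α m') * Mom θ (α + Pi.single m 1) := by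
  have h1 := mom_rel0 θ hθ α m
  have h2 := mom_rel0 θ hθ α m'
  have h0 : 0 < θ + (α 0 : ℝ) := by positivity
  apply mul_left_cancel₀ h0.ne'
  calc _ = (θ + α m) * ((θ + α 0) * Mom θ (α + Pi.single m' 1)) := by ring
    _ = (θ + α m') * ((θ + α m) * Mom θ (α + Pi.single 0 1)) := by rw [← h2]; ring
    _ = _ := by rw [h1]; ring

noncomputable def Ew {k : ℕ} (θ : ℝ) (hθ : 0 < θ) : MvPolynomial (Fin (k+1)) ℝ →ₗ[ℝ] ℝ where
  toFun g := ∫ w in TT k, rho θ w * MvPolynomial.eval (wb w) g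
  map_add' f g := by
    have hc : ∀ g : MvPolynomial (Fin (k+1)) ℝ, Continuous fun w : Fin k → ℝ => MvPolynomial.eval (wb w) g :=
      fun g => (MvPolynomial.continuous_eval g).comp (continuous_pi fun j => wb_continuous k j)
    simp only [map_add, mul_add]
    exact integral_add (rho_mul_integrable k θ hθ _ (hc f)) (rho_mul_integrable k θ hθ _ (hc g))
  map_smul' r g := by
    simp only [MvPolynomial.smul_eval, RingHom.id_apply, smul_eq_mul]
    rw [← integral_const_mul]
    congr 1; funext w; ring

theorem Ew_apply {k : ℕ} (θ : ℝ) (hθ : 0 < θ) (g : MvPolynomial (Fin (k+1)) ℝ) :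
    Ew θ hθ g = ∫ w in TT k, rho θ w * MvPolynomial.eval (wb w) g := rfl

theorem Ew_monomial {k : ℕ} (θ : ℝ) (hθ : 0 < θ) (s : Fin (k+1) →₀ ℕ) (a : ℝ) :
    Ew θ hθ (MvPolynomial.monomial s a) = a * Mom θ s := by
  rw [Ew_apply, Mom, ← integral_const_mul]
  congr 1; funext w
  rw [MvPolynomial.eval_monomial, Finsupp.prod_fintype _ _ (by simp)]; ring

theorem Ew_X_mul {k : ℕ} (θ : ℝ) (hθ : 0 < θ) (s : Fin (k+1) →₀ ℕ) (a : ℝ) (m : Fin (k+1)) :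
    Ew θ hθ (MvPolynomial.X m * MvPolynomial.monomial s a) = a * Mom θ ((s : Fin (k+1) → ℕ) + Pi.single m 1) := by
  rw [MvPolynomial.X, MvPolynomial.monomial_mul, Ew_monomial, one_mul]
  congr 2
  funext j
  simp [Finsupp.single_apply, Pi.single_apply, add_comm, eq_comm]

theorem X_pderiv (k : ℕ) (s : Fin k →₀ ℕ) (a : ℝ) (m : Fin k) :
    MvPolynomial.X m * MvPolynomial.pderiv m (MvPolynomial.monomial s a) = (s m : ℝ) • MvPolynomial.monomial s a := by
  rw [MvPolynomial.X_mul_pderiv_monomial]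
  rw [Nat.cast_smul_eq_nsmul]

theorem Ew_ibp {k : ℕ} (θ : ℝ) (hθ : 0 < θ) (g : MvPolynomial (Fin (k+1)) ℝ) (m m' : Fin (k+1)) :
    Ew θ hθ (MvPolynomial.X m * MvPolynomial.X m' * (MvPolynomial.pderiv m g - MvPolynomial.pderiv m' g) +
      MvPolynomial.C θ * (MvPolynomial.X m' - MvPolynomial.X m) * g) = 0 := by
  induction g using MvPolynomial.induction_on' with
  | monomial s a =>
    have e : MvPolynomial.X m * MvPolynomial.X m' * (MvPolynomial.pderiv m (MvPolynomial.monomial s a) - 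
        MvPolynomial.pderiv m' (MvPolynomial.monomial s a)) +
      MvPolynomial.C θ * (MvPolynomial.X m' - MvPolynomial.X m) * MvPolynomial.monomial s a = 
      (θ + s m) • (MvPolynomial.X m' * MvPolynomial.monomial s a) - 
      (θ + s m') • (MvPolynomial.X m * MvPolynomial.monomial s a) := by
      calc _ = MvPolynomial.X m' * (MvPolynomial.X m * MvPolynomial.pderiv m (MvPolynomial.monomial s a)) -
            MvPolynomial.X m * (MvPolynomial.X m' * MvPolynomial.pderiv m' (MvPolynomial.monomial s a)) +
            MvPolynomial.C θ * (MvPolynomial.X m' - MvPolynomial.X m) * MvPolynomial.monomial s a := by ring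
        _ = _ := by
          rw [X_pderiv, X_pderiv]
          simp only [MvPolynomial.smul_eq_C_mul, MvPolynomial.C_add]
          ring
    rw [e, map_sub, map_smul, map_smul, Ew_X_mul, Ew_X_mul, smul_eq_mul, smul_eq_mul]
    have := mom_rel θ hθ s m m'
    linear_combination a * this
  | add p q hp hq =>
    rw [← add_zero (0:ℝ)]
    nth_rewrite 1 [← hp]
    rw [← hq, ← map_add]
    congr 1
    simp only [map_add]
    ring

section
variable {A B : Type*}

theorem span_prod (G : MvPolynomial (A ⊕ B) ℝ) : G ∈ Submodule.span ℝ
    {G | ∃ (a : MvPolynomial A ℝ) (b : MvPolynomial B ℝ), G = MvPolynomial.rename Sum.inl a * MvPolynomial.rename Sum.inr b} := by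
  induction G using MvPolynomial.induction_on with
  | C r => exact Submodule.subset_span ⟨MvPolynomial.C r, 1, by simp⟩
  | add p q hp hq => exact Submodule.add_mem _ hp hq
  | mul_X p n hp =>
    induction hp using Submodule.span_induction with
    | mem G h =>
      obtain ⟨a, b, rfl⟩ := h
      apply Submodule.subset_span
      cases n with
      | inl i => exact ⟨a * MvPolynomial.X i, b, by simp; ring⟩
      | inr i => exact ⟨a, b * MvPolynomial.X i, by simp; ring⟩
    | zero => simp
    | add p q _ _ hp hq => rw [add_mul]; exact Submodule.add_mem _ hp hq
    | smul r p _ hp => rw [smul_mul_assoc]; exact Submodule.smul_mem _ _ hp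

theorem pderiv_inl_prod (i : A) (a : MvPolynomial A ℝ) (b : MvPolynomial B ℝ) :
    MvPolynomial.pderiv (Sum.inl i) (MvPolynomial.rename Sum.inl a * MvPolynomial.rename (Sum.inr : B → A ⊕ B) b) =
    MvPolynomial.rename Sum.inl (MvPolynomial.pderiv i a) * MvPolynomial.rename Sum.inr b := by
  have h1 : MvPolynomial.pderiv (Sum.inl i) (MvPolynomial.rename (Sum.inl : A → A ⊕ B) a) = 
      MvPolynomial.rename Sum.inl (MvPolynomial.pderiv i a) := by
    classical
    induction a using MvPolynomial.induction_on with
    | C r => simp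
    | add p q hp hq => simp [hp, hq]
    | mul_X p n hp => 
      simp [hp, MvPolynomial.pderiv_X, Pi.single_apply]
      split_ifs <;> simp
  have h2 : MvPolynomial.pderiv (Sum.inl i) (MvPolynomial.rename (Sum.inr : B → A ⊕ B) b) = 0 := by
    classical
    induction b using MvPolynomial.induction_on with
    | C r => simp
    | add p q hp hq => simp [hp, hq]
    | mul_X p n hp => simp [hp, MvPolynomial.pderiv_X, Pi.single_apply]
  rw [Derivation.leibniz, h1, h2]
  simp [mul_comm]

theorem pderiv_inr_prod (i : B) (a : MvPolynomial A ℝ) (b : MvPolynomial B ℝ) :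
    MvPolynomial.pderiv (Sum.inr i) (MvPolynomial.rename (Sum.inl : A → A ⊕ B) a * MvPolynomial.rename (Sum.inr : B → A ⊕ B) b) =
    MvPolynomial.rename Sum.inl a * MvPolynomial.rename Sum.inr (MvPolynomial.pderiv i b) := by
  have h1 : MvPolynomial.pderiv (Sum.inr i) (MvPolynomial.rename (Sum.inr : B → A ⊕ B) b) = 
      MvPolynomial.rename Sum.inr (MvPolynomial.pderiv i b) := by
    classical
    induction b using MvPolynomial.induction_on with
    | C r => simp
    | add p q hp hq => simp [hp, hq]
    | mul_X p n hp => 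
      simp [hp, MvPolynomial.pderiv_X, Pi.single_apply]
      split_ifs <;> simp
  have h2 : MvPolynomial.pderiv (Sum.inr i) (MvPolynomial.rename (Sum.inl : A → A ⊕ B) a) = 0 := by
    classical
    induction a using MvPolynomial.induction_on with
    | C r => simp
    | add p q hp hq => simp [hp, hq]
    | mul_X p n hp => simp [hp, MvPolynomial.pderiv_X, Pi.single_apply]
  rw [Derivation.leibniz, h1, h2]
  simp [mul_comm]

theorem aeval_prod (x : A → ℝ) (w : B → ℝ) (a : MvPolynomial A ℝ) (b : MvPolynomial B ℝ) :
    MvPolynomial.aeval (Sum.elim x w) (MvPolynomial.rename Sum.inl a * MvPolynomial.rename Sum.inr b) =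
    MvPolynomial.eval x a * MvPolynomial.eval w b := by
  rw [map_mul, MvPolynomial.aeval_rename, MvPolynomial.aeval_rename, Sum.elim_comp_inl, Sum.elim_comp_inr]
  rfl
end

noncomputable def II {k : ℕ} (θ : ℝ) (hθ : 0 < θ) (x : Fin (k+1) → ℝ) : 
    MvPolynomial (Fin (k+1) ⊕ Fin (k+1)) ℝ →ₗ[ℝ] ℝ := 
  (Ew θ hθ).comp (MvPolynomial.aeval (Sum.elim (fun j => MvPolynomial.C (x j)) MvPolynomial.X)).toLinearMap

theorem II_apply {k : ℕ} (θ : ℝ) (hθ : 0 < θ) (x : Fin (k+1) → ℝ) (G : MvPolynomial (Fin (k+1) ⊕ Fin (k+1)) ℝ) :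
    II θ hθ x G = ∫ w in TT k, rho θ w * MvPolynomial.aeval (Sum.elim x (wb w)) G := by
  rw [II, LinearMap.comp_apply, Ew_apply]
  congr 1; funext w; congr 1
  have : ((MvPolynomial.aeval (wb w)).comp (MvPolynomial.aeval (R := ℝ) (Sum.elim (fun j => MvPolynomial.C (x j)) MvPolynomial.X))) =
      MvPolynomial.aeval (R := ℝ) (Sum.elim x (wb w)) := by
    apply MvPolynomial.algHom_ext
    rintro (j | j) <;> simp
  rw [← this]; rfl

theorem II_int {k : ℕ} (θ : ℝ) (hθ : 0 < θ) (x : Fin (k+1) → ℝ) (G : MvPolynomial (Fin (k+1) ⊕ Fin (k+1)) ℝ) :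
    IntegrableOn (fun w => rho θ w * MvPolynomial.aeval (Sum.elim x (wb w)) G) (TT k) := by
  refine rho_mul_integrable k θ hθ _ ?_
  change Continuous fun w : Fin k → ℝ => MvPolynomial.eval (Sum.elim x (wb w)) G
  refine (MvPolynomial.continuous_eval G).comp (continuous_pi ?_)
  rintro (j | j)
  · exact continuous_const
  · exact wb_continuous k j

theorem II_prod {k : ℕ} (θ : ℝ) (hθ : 0 < θ) (x : Fin (k+1) → ℝ) (a b : MvPolynomial (Fin (k+1)) ℝ) :
    II θ hθ x (MvPolynomial.rename Sum.inl a * MvPolynomial.rename Sum.inr b) = 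
      MvPolynomial.eval x a * Ew θ hθ b := by
  rw [II_apply, Ew_apply, ← integral_const_mul]
  congr 1; funext w
  rw [aeval_prod]; ring

theorem II_ibp {k : ℕ} (θ : ℝ) (hθ : 0 < θ) (x : Fin (k+1) → ℝ) (G : MvPolynomial (Fin (k+1) ⊕ Fin (k+1)) ℝ) (m m' : Fin (k+1)) :
    II θ hθ x (MvPolynomial.X (Sum.inr m) * MvPolynomial.X (Sum.inr m') * (MvPolynomial.pderiv (Sum.inr m) G - MvPolynomial.pderiv (Sum.inr m') G) +
      MvPolynomial.C θ * (MvPolynomial.X (Sum.inr m') - MvPolynomial.X (Sum.inr m)) * G) = 0 := by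
  induction span_prod G using Submodule.span_induction with
  | mem G h =>
    obtain ⟨a, b, rfl⟩ := h
    rw [pderiv_inr_prod, pderiv_inr_prod]
    have e := II_prod θ hθ x a (MvPolynomial.X m * MvPolynomial.X m' * (MvPolynomial.pderiv m b - MvPolynomial.pderiv m' b) +
      MvPolynomial.C θ * (MvPolynomial.X m' - MvPolynomial.X m) * b)
    rw [Ew_ibp, mul_zero] at e
    rw [← e]
    congr 1
    simp only [map_add, map_mul, map_sub, MvPolynomial.rename_X, MvPolynomial.rename_C]
    ring
  | zero => simp
  | add p q _ _ hp hq =>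
    rw [← add_zero (0:ℝ)]
    nth_rewrite 1 [← hp]
    rw [← hq, ← map_add]
    congr 1
    simp only [map_add]
    ring
  | smul r p _ hp =>
    rw [← smul_zero r, ← hp, ← LinearMap.map_smul]
    congr 1
    rw [Derivation.map_smul, Derivation.map_smul]
    simp only [MvPolynomial.smul_eq_C_mul]
    ring

theorem II_poly {k : ℕ} (θ : ℝ) (hθ : 0 < θ) (G : MvPolynomial (Fin (k+1) ⊕ Fin (k+1)) ℝ) :
    ∃ Q : MvPolynomial (Fin (k+1)) ℝ, ∀ x, II θ hθ x G = MvPolynomial.eval x Q ∧ 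
      ∀ i, II θ hθ x (MvPolynomial.pderiv (Sum.inl i) G) = MvPolynomial.eval x (MvPolynomial.pderiv i Q) ∧
      II θ hθ x (MvPolynomial.pderiv (Sum.inl i) (MvPolynomial.pderiv (Sum.inl i) G)) = 
        MvPolynomial.eval x (MvPolynomial.pderiv i (MvPolynomial.pderiv i Q)) := by
  induction span_prod G using Submodule.span_induction with
  | mem G h =>
    obtain ⟨a, b, rfl⟩ := h
    refine ⟨Ew θ hθ b • a, fun x => ⟨?_, fun i => ⟨?_, ?_⟩⟩⟩
    · rw [II_prod, MvPolynomial.smul_eval, mul_comm]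
    · rw [pderiv_inl_prod, II_prod, Derivation.map_smul, MvPolynomial.smul_eval, mul_comm]
    · rw [pderiv_inl_prod, pderiv_inl_prod, II_prod, Derivation.map_smul, Derivation.map_smul, MvPolynomial.smul_eval, mul_comm]
  | zero => exact ⟨0, by simp⟩
  | add p q _ _ hp hq =>
    obtain ⟨P, hP⟩ := hp
    obtain ⟨Q, hQ⟩ := hq
    refine ⟨P + Q, fun x => ⟨?_, fun i => ⟨?_, ?_⟩⟩⟩
    · simp only [map_add, (hP x).1, (hQ x).1]
    · simp only [map_add, ((hP x).2 i).1, ((hQ x).2 i).1]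
    · simp only [map_add, ((hP x).2 i).2, ((hQ x).2 i).2]
  | smul r p _ hp =>
    obtain ⟨P, hP⟩ := hp
    refine ⟨r • P, fun x => ⟨?_, fun i => ⟨?_, ?_⟩⟩⟩
    · simp only [map_smul, (hP x).1, MvPolynomial.smul_eval, smul_eq_mul]
    · simp only [Derivation.map_smul, map_smul, ((hP x).2 i).1, MvPolynomial.smul_eval, smul_eq_mul]
    · simp only [Derivation.map_smul, map_smul, ((hP x).2 i).2, MvPolynomial.smul_eval, smul_eq_mul]


theorem J_eq {k : ℕ} (β : ℝ) (hβ : 0 < β / 2) {x : Fin (k+1) → ℝ} (hx : StrictMono x) (F : MvPolynomial ℝ ℝ) :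
    ∫ y in DAdomain k x, DAdensity k β x y * MvPolynomial.eval y (MvPolynomial.aeval (pY k) F) =
      kap k β * II (β/2) hβ x (MvPolynomial.aeval (pX k) F) := by
  rw [cov β hx _ (fun w => MvPolynomial.aeval (Sum.elim x w) (MvPolynomial.aeval (pX k) F)), II_apply]
  intro y hy
  exact point_eval x (Phi x y) y (Phi_hR hx.injective y) F

theorem II_gen {k : ℕ} (θ : ℝ) (hθ : 0 < θ) (x : Fin (k+1) → ℝ) (G : MvPolynomial (Fin (k+1) ⊕ Fin (k+1)) ℝ) :
    ∫ w in TT k, rho θ w * Lop (MvPolynomial.aeval (Sum.elim x (wb w))) (DX k) (cX x (wb w)) (eX θ x (wb w)) G =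
    ∑ j, ((1/2) * II θ hθ x (MvPolynomial.pderiv (Sum.inl j) (MvPolynomial.pderiv (Sum.inl j) G)) +
      drift θ x j * II θ hθ x (MvPolynomial.pderiv (Sum.inl j) G)) := by
  let E := fun p : Fin (k+1) × Fin (k+1) => MvPolynomial.pderiv (Sum.inr p.1) G - MvPolynomial.pderiv (Sum.inr p.2) G
  let K := fun p : Fin (k+1) × Fin (k+1) => (MvPolynomial.X (Sum.inr p.1) * MvPolynomial.X (Sum.inr p.2) *
      (MvPolynomial.pderiv (Sum.inr p.1) (E p) - MvPolynomial.pderiv (Sum.inr p.2) (E p)) +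
      MvPolynomial.C θ * (MvPolynomial.X (Sum.inr p.2) - MvPolynomial.X (Sum.inr p.1)) * (E p) :
        MvPolynomial (Fin (k+1) ⊕ Fin (k+1)) ℝ)
  let H := ∑ j, ((1/2 : ℝ) • (MvPolynomial.pderiv (Sum.inl j) (MvPolynomial.pderiv (Sum.inl j) G)) +
      drift θ x j • (MvPolynomial.pderiv (Sum.inl j) G)) +
      ∑ p : Fin (k+1) × Fin (k+1), ((1/2) * ((x p.1 - x p.2) ^ 2)⁻¹) • K p
  have h1 : II θ hθ x H = ∑ j, ((1/2) * II θ hθ x (MvPolynomial.pderiv (Sum.inl j) (MvPolynomial.pderiv (Sum.inl j) G)) +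
      drift θ x j * II θ hθ x (MvPolynomial.pderiv (Sum.inl j) G)) := by
    simp only [H, map_add, map_sum, LinearMap.map_smul, smul_eq_mul]
    rw [Finset.sum_eq_zero (s := (univ : Finset (Fin (k+1) × Fin (k+1)))), add_zero]
    intro p _
    rw [II_ibp, mul_zero]
  rw [← h1, II_apply]
  congr 1; funext w; congr 1
  simp only [H, K, E, Lop, Fintype.sum_sum_type, DX, cX, eX, Sum.elim_inl, Sum.elim_inr, map_add, map_sum,
    AlgHom.map_smul_of_tower, smul_eq_mul, map_mul, map_sub, Derivation.sub_apply, MvPolynomial.aeval_X, MvPolynomial.aeval_C]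
  congr 1
  refine sum_congr rfl fun p _ => ?_
  simp only [Algebra.algebraMap_self, RingHom.id_apply]
  ring

theorem intertwine {k : ℕ} (β : ℝ) (hβ : 0 < β / 2) (f : MvPolynomial (Fin k) ℝ) (hf : f.IsSymmetric) :
    ∃ Q : MvPolynomial (Fin (k+1)) ℝ, ∀ x : Fin (k+1) → ℝ, StrictMono x →
      (∫ y in DAdomain k x, DAdensity k β x y * MvPolynomial.eval y f = MvPolynomial.eval x Q) ∧
      (∫ y in DAdomain k x, DAdensity k β x y * genOU (β/2) (fun y => MvPolynomial.eval y f) y =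
        genOU (β/2) (fun x => MvPolynomial.eval x Q) x) := by
  obtain ⟨F, rfl⟩ := symm_range k f hf
  obtain ⟨Q, hQ⟩ := II_poly (β/2) hβ (MvPolynomial.aeval (pX k) F)
  refine ⟨kap k β • Q, fun x hx => ⟨?_, ?_⟩⟩
  · rw [J_eq β hβ hx, (hQ x).1, MvPolynomial.smul_eval]
  · rw [cov β hx _ (fun w => Lop (MvPolynomial.aeval (Sum.elim x w)) (DX k) (cX x w) (eX (β/2) x w)
      (MvPolynomial.aeval (pX k) F)), II_gen _ hβ, genOU_eval]
    · unfold Lop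
      rw [mul_sum]
      refine sum_congr rfl fun j _ => ?_
      rw [((hQ x).2 j).1, ((hQ x).2 j).2, Derivation.map_smul, Derivation.map_smul]
      rw [map_smul, map_smul, smul_eq_mul, smul_eq_mul]
      simp only [MvPolynomial.coe_aeval_eq_eval]
      simp only [RingHom.coe_coe, MvPolynomial.aeval_eq_eval]
      ring
    · intro y hy
      rw [genOU_eval]
      exact point_identity x (Phi x y) y (Phi_hR hx.injective y) (β/2) hx.injective
        (Wo_strictMono hx hy).injective F


theorem sep_strictMono {n : ℕ} (p : MvPolynomial (Fin n) ℝ)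
    (h : ∀ x : Fin n → ℝ, StrictMono x → MvPolynomial.eval x p = 0) : p = 0 := by
  refine MvPolynomial.funext_set (fun j : Fin n => Set.Ioo ((j : ℕ) : ℝ) ((j : ℕ) + 1 : ℝ))
    (fun j => Set.Ioo_infinite (by linarith)) ?_
  intro x hx
  rw [map_zero]
  apply h
  intro i j hij
  have h1 := (hx i (Set.mem_univ i)).2
  have h2 := (hx j (Set.mem_univ j)).1
  have h3 : ((i : ℕ) : ℝ) + 1 ≤ ((j : ℕ) : ℝ) := by exact_mod_cast hij
  linarith

noncomputable def genL {m : ℕ} (θ : ℝ) (z : Fin m → ℝ) : MvPolynomial (Fin m) ℝ →ₗ[ℝ] ℝ where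
  toFun f := genOU θ (fun z => MvPolynomial.eval z f) z
  map_add' f g := by
    simp only [genOU_eval, Lop_add]
  map_smul' r f := by
    simp only [genOU_eval, Lop, Derivation.map_smul, map_smul, smul_eq_mul, RingHom.id_apply, mul_sum]
    exact sum_congr rfl fun j _ => by ring

noncomputable def evL {m : ℕ} (z : Fin m → ℝ) : MvPolynomial (Fin m) ℝ →ₗ[ℝ] ℝ :=
  (MvPolynomial.aeval z).toLinearMap

theorem evL_apply {m : ℕ} (z : Fin m → ℝ) (f : MvPolynomial (Fin m) ℝ) : evL z f = MvPolynomial.eval z f := rfl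

theorem genL_apply {m : ℕ} (θ : ℝ) (z : Fin m → ℝ) (f : MvPolynomial (Fin m) ℝ) :
  genL θ z f = genOU θ (fun z => MvPolynomial.eval z f) z := rfl

instance fd_restrict (n d : ℕ) : FiniteDimensional ℝ (MvPolynomial.restrictTotalDegree (Fin n) ℝ d) := by
  infer_instance

noncomputable def Usub (k d : ℕ) : Submodule ℝ (MvPolynomial (Fin k) ℝ) :=
  (MvPolynomial.symmetricSubalgebra (Fin k) ℝ).toSubmodule ⊓ MvPolynomial.restrictTotalDegree (Fin k) ℝ d

instance fd_Usub (k d : ℕ) : FiniteDimensional ℝ (Usub k d) :=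
  Submodule.finiteDimensional_of_le (inf_le_right : Usub k d ≤ MvPolynomial.restrictTotalDegree (Fin k) ℝ d)

theorem J_add {k : ℕ} (β : ℝ) (hβ : 0 < β / 2) {x : Fin (k+1) → ℝ} (hx : StrictMono x)
    (f g : MvPolynomial (Fin k) ℝ) (hf : f.IsSymmetric) (hg : g.IsSymmetric) :
    ∫ y in DAdomain k x, DAdensity k β x y * MvPolynomial.eval y (f + g) =
    (∫ y in DAdomain k x, DAdensity k β x y * MvPolynomial.eval y f) +
    ∫ y in DAdomain k x, DAdensity k β x y * MvPolynomial.eval y g := by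
  obtain ⟨F, rfl⟩ := symm_range k f hf
  obtain ⟨G, rfl⟩ := symm_range k g hg
  rw [← map_add, J_eq β hβ hx, J_eq β hβ hx, J_eq β hβ hx, map_add, map_add, mul_add]

theorem LL_exists {k : ℕ} (d : ℕ) (β : ℝ) (hβ : 0 < β / 2) :
    ∃ L : Usub k d →ₗ[ℝ] MvPolynomial (Fin (k+1)) ℝ, ∀ f : Usub k d, ∀ x : Fin (k+1) → ℝ, StrictMono x →
      (∫ y in DAdomain k x, DAdensity k β x y * MvPolynomial.eval y f.1 = MvPolynomial.eval x (L f)) ∧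
      (∫ y in DAdomain k x, DAdensity k β x y * genOU (β/2) (fun y => MvPolynomial.eval y f.1) y =
        genOU (β/2) (fun x => MvPolynomial.eval x (L f)) x) := by
  have hs : ∀ f : Usub k d, f.1.IsSymmetric := fun f => f.2.1
  choose Q hQ using fun f : Usub k d => intertwine β hβ f.1 (hs f)
  refine ⟨{ toFun := Q, map_add' := ?_, map_smul' := ?_ }, hQ⟩
  · intro f g
    rw [← sub_eq_zero]
    apply sep_strictMono
    intro x hx
    rw [map_sub, map_add, ← (hQ _ x hx).1, ← (hQ _ x hx).1, ← (hQ _ x hx).1, Submodule.coe_add,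
      J_add β hβ hx _ _ (hs f) (hs g), sub_self]
  · intro r f
    rw [← sub_eq_zero]
    apply sep_strictMono
    intro x hx
    rw [map_sub, RingHom.id_apply, MvPolynomial.smul_eval, ← (hQ _ x hx).1, ← (hQ _ x hx).1, ← integral_const_mul, sub_eq_zero]
    congr 1; funext y
    rw [Submodule.coe_smul, MvPolynomial.smul_eval]; ring

theorem intertwine_main (β : ℝ) (hβ : 0 < β) (k d : ℕ) 
    (u : ℝ → MvPolynomial (Fin k) ℝ) (v : ℝ → MvPolynomial (Fin (k + 1)) ℝ)
    (hu : ∀ t, u t ∈ Usub k d) (hv : ∀ t, v t ∈ MvPolynomial.restrictTotalDegree (Fin (k+1)) ℝ d)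
    (hu_eq : ∀ t : ℝ, 0 ≤ t → ∀ z : Fin k → ℝ, Function.Injective z →
      HasDerivWithinAt (fun s => evL z (u s)) (genL (β / 2) z (u t)) (Set.Ici 0) t)
    (hv_init : ∀ x : Fin (k + 1) → ℝ, StrictMono x →
      evL x (v 0) = ∫ y in DAdomain k x, DAdensity k β x y * MvPolynomial.eval y (u 0))
    (hv_eq : ∀ t : ℝ, 0 ≤ t → ∀ x : Fin (k + 1) → ℝ, Function.Injective x →
      HasDerivWithinAt (fun s => evL x (v s)) (genL (β / 2) x (v t)) (Set.Ici 0) t) :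
    ∀ t : ℝ, 0 ≤ t → ∀ x : Fin (k + 1) → ℝ, StrictMono x →
      (∫ y in DAdomain k x, DAdensity k β x y * MvPolynomial.eval y (u t)) = MvPolynomial.eval x (v t) := by
  have hβ2 : 0 < β / 2 := by linarith
  obtain ⟨L, hL⟩ := LL_exists (k := k) d β hβ2
  let U : ℝ → Usub k d := fun t => ⟨u t, hu t⟩
  obtain ⟨M, hM⟩ := ode_lin (X := {z : Fin k → ℝ // StrictMono z})
    (fun z => (evL z.1).comp (Usub k d).subtype) (fun z => (genL (β/2) z.1).comp (Usub k d).subtype)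
    (fun f hf => Subtype.ext (sep_strictMono f.1 fun x hx => hf ⟨x, hx⟩)) U
    (fun t ht z => hu_eq t ht z.1 z.2.injective)
  have hMg : ∀ t : ℝ, 0 ≤ t → ∀ z : Fin k → ℝ, Function.Injective z →
      MvPolynomial.eval z (M (U t)).1 = genOU (β/2) (fun y => MvPolynomial.eval y (u t)) z := by
    intro t ht z hz
    exact (uniqueDiffOn_Ici (0:ℝ) t ht).eq_deriv _ (hM ((evL z).comp (Usub k d).subtype) t ht) (hu_eq t ht z hz)
  have hLd : ∀ t : ℝ, 0 ≤ t → ∀ x : Fin (k+1) → ℝ, StrictMono x →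
      HasDerivWithinAt (fun s => evL x (L (U s))) (genL (β/2) x (L (U t))) (Set.Ici 0) t := by
    intro t ht x hx
    have h1 := hM ((evL x).comp L) t ht
    have h2 : ((evL x).comp L) (M (U t)) = genL (β/2) x (L (U t)) := by
      rw [LinearMap.comp_apply, evL_apply, genL_apply, ← (hL _ x hx).1, ← (hL _ x hx).2]
      rw [← setIntegral_congr_set (Wo_ae x), ← setIntegral_congr_set (Wo_ae x)]
      refine setIntegral_congr_fun (Wo_open x).measurableSet fun y hy => ?_
      rw [hMg t ht y (Wo_strictMono hx hy).injective]
    rw [h2] at h1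
    exact h1
  let V := MvPolynomial.restrictTotalDegree (Fin (k+1)) ℝ d ⊔ LinearMap.range L
  have hVmem : ∀ t, L (U t) - v t ∈ V := fun t =>
    Submodule.sub_mem _ (Submodule.mem_sup_right ⟨U t, rfl⟩) (Submodule.mem_sup_left (hv t))
  have key := ode_uniq (X := {z : Fin (k+1) → ℝ // StrictMono z})
    (fun z => (evL z.1).comp V.subtype) (fun z => (genL (β/2) z.1).comp V.subtype)
    (fun f hf => Subtype.ext (sep_strictMono f.1 fun x hx => hf ⟨x, hx⟩)) (fun t => ⟨L (U t) - v t, hVmem t⟩)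
    (by
      intro t ht z
      simp only [LinearMap.comp_apply, Submodule.subtype_apply, map_sub]
      exact (hLd t ht z.1 z.2).sub (hv_eq t ht z.1 z.2.injective))
    (by
      refine Subtype.ext (sep_strictMono _ fun x hx => ?_)
      simp only [map_sub]
      rw [← (hL _ x hx).1, ← evL_apply x (v 0), hv_init x hx, sub_self])
  intro t ht x hx
  have h3 := congrArg Subtype.val (key t ht)
  have h4 : L (U t) = v t := sub_eq_zero.1 h3
  rw [← h4, ← (hL (U t) x hx).1]

theorem DA_intertwines_OU_semigroups (β : ℝ) (hβ : 0 < β) (k : ℕ) (hk : 1 ≤ k)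
    (P : MvPolynomial (Fin k) ℝ) (hP : P.IsSymmetric)
    (u : ℝ → (Fin k → ℝ) → ℝ) (v : ℝ → (Fin (k + 1) → ℝ) → ℝ)
    (hu_poly : ∀ t : ℝ, 0 ≤ t → ∃ Pt : MvPolynomial (Fin k) ℝ, Pt.IsSymmetric ∧
      Pt.totalDegree ≤ P.totalDegree ∧ ∀ z, u t z = MvPolynomial.eval z Pt)
    (hu_C1 : ∀ z, ContDiffOn ℝ 1 (fun t => u t z) (Set.Ici 0))
    (hu_init : ∀ z, u 0 z = MvPolynomial.eval z P)
    (hu_eq : ∀ t : ℝ, 0 ≤ t → ∀ z : Fin k → ℝ, Function.Injective z →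
      HasDerivWithinAt (fun s => u s z) (genOU (β / 2) (u t) z) (Set.Ici 0) t)
    (hv_poly : ∀ t : ℝ, 0 ≤ t → ∃ Qt : MvPolynomial (Fin (k + 1)) ℝ, Qt.IsSymmetric ∧
      Qt.totalDegree ≤ P.totalDegree ∧ ∀ x, v t x = MvPolynomial.eval x Qt)
    (hv_C1 : ∀ x, ContDiffOn ℝ 1 (fun t => v t x) (Set.Ici 0))
    (hv_init : ∀ x : Fin (k + 1) → ℝ, StrictMono x →
      v 0 x = ∫ y in DAdomain k x, DAdensity k β x y * MvPolynomial.eval y P)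
    (hv_eq : ∀ t : ℝ, 0 ≤ t → ∀ x : Fin (k + 1) → ℝ, Function.Injective x →
      HasDerivWithinAt (fun s => v s x) (genOU (β / 2) (v t) x) (Set.Ici 0) t) :
    ∀ t : ℝ, 0 ≤ t → ∀ x : Fin (k + 1) → ℝ, StrictMono x →
      (∫ y in DAdomain k x, DAdensity k β x y * u t y) = v t x := by

  choose pu hpu using hu_poly
  choose pv hpv using hv_poly
  have main := intertwine_main β hβ k P.totalDegree
    (fun t => if h : 0 ≤ t then pu t h else 0) (fun t => if h : 0 ≤ t then pv t h else 0)
    (by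
      intro t
      split_ifs with h
      · exact ⟨(hpu t h).1, (MvPolynomial.mem_restrictTotalDegree _ _ _).2 (hpu t h).2.1⟩
      · exact Submodule.zero_mem _)
    (by
      intro t
      split_ifs with h
      · exact (MvPolynomial.mem_restrictTotalDegree _ _ _).2 (hpv t h).2.1
      · exact Submodule.zero_mem _)
    (by
      intro t ht z hz
      have h := hu_eq t ht z hz
      have e : u t = fun z => MvPolynomial.eval z (pu t ht) := funext (hpu t ht).2.2
      rw [e] at h
      simp only [dif_pos ht]
      rw [genL_apply]
      refine h.congr_of_mem (fun s hs => ?_) ht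
      have hs' : (0:ℝ) ≤ s := hs
      rw [dif_pos hs', evL_apply, (hpu s hs').2.2])
    (by
      intro x hx
      simp only [dif_pos (le_refl (0:ℝ))]
      rw [evL_apply, ← (hpv 0 le_rfl).2.2, hv_init x hx]
      simp only [← (hpu 0 le_rfl).2.2, hu_init])
    (by
      intro t ht z hz
      have h := hv_eq t ht z hz
      have e : v t = fun z => MvPolynomial.eval z (pv t ht) := funext (hpv t ht).2.2
      rw [e] at h
      simp only [dif_pos ht]
      rw [genL_apply]
      refine h.congr_of_mem (fun s hs => ?_) ht
      have hs' : (0:ℝ) ≤ s := hs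
      rw [dif_pos hs', evL_apply, (hpv s hs').2.2])
  intro t ht x hx
  have := main t ht x hx
  simp only [dif_pos ht] at this
  rw [(hpv t ht).2.2, ← this]
  simp only [(hpu t ht).2.2]
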